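/- arXiv:1603.04193 — 5 statements merged into one kernel-verified Lean document; each statement's English description precedes it below -/
import Mathlib

section
/- Let X ⊆ ℝⁿ be a real algebraic set whose singular locus X \ X_reg is a finite set (i.e. X has only isolated singularities). Then every rational continuous function on X is regulous, i.e. is the restriction to X of a regulous function on ℝⁿ. -/
open MvPolynomial Set

/-- A real algebraic set: the common zero locus of finitely many real polynomials. -/
def IsRealAlgebraicSet {n : ℕ} (X : Set (Fin n → ℝ)) : Prop :=
  ∃ (k : ℕ) (p : Fin k → MvPolynomial (Fin n) ℝ),
    X = {x | ∀ i, MvPolynomial.eval x (p i) = 0}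

/-- `V` is a real algebraic subset of `X`, i.e. a Zariski closed subset of `X`. -/
def IsZariskiClosedIn {n : ℕ} (X V : Set (Fin n → ℝ)) : Prop :=
  IsRealAlgebraicSet V ∧ V ⊆ X

/-- `U` is a Zariski open subset of `X`. -/
def IsZariskiOpenIn {n : ℕ} (X U : Set (Fin n → ℝ)) : Prop :=
  U ⊆ X ∧ IsRealAlgebraicSet (X \ U)

/-- `U` is Zariski dense in `X`. -/
def IsZariskiDenseIn {n : ℕ} (X U : Set (Fin n → ℝ)) : Prop :=
  ∀ V, IsZariskiClosedIn X V → U ⊆ V → V = X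

/-- `f` is regular on `U` : on `U`, `f = p / q` with `q` nonvanishing on `U`. -/
def IsRegularOnSet {n : ℕ} (U : Set (Fin n → ℝ)) (f : (Fin n → ℝ) → ℝ) : Prop :=
  ∃ p q : MvPolynomial (Fin n) ℝ,
    (∀ x ∈ U, MvPolynomial.eval x q ≠ 0) ∧
    ∀ x ∈ U, f x = MvPolynomial.eval x p / MvPolynomial.eval x q

/-- A rational continuous function on `X`: continuous on `X` (euclidean topology) and
regular on a Zariski-dense Zariski-open subset of `X`. -/
def IsRatCont {n : ℕ} (X : Set (Fin n → ℝ)) (f : (Fin n → ℝ) → ℝ) : Prop :=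
  ContinuousOn f X ∧
    ∃ U, IsZariskiOpenIn X U ∧ IsZariskiDenseIn X U ∧ IsRegularOnSet U f

/-- A regulous function on `ℝⁿ`: continuous, and equal to a quotient of polynomials on a
nonempty Zariski open subset of `ℝⁿ`. -/
def IsRegulous {n : ℕ} (f : (Fin n → ℝ) → ℝ) : Prop :=
  Continuous f ∧
    ∃ U : Set (Fin n → ℝ), IsZariskiOpenIn Set.univ U ∧ U.Nonempty ∧ IsRegularOnSet U f

/-- A regulous function on `X`: the restriction to `X` of a regulous function on `ℝⁿ`. -/
def IsRegulousOn {n : ℕ} (X : Set (Fin n → ℝ)) (f : (Fin n → ℝ) → ℝ) : Prop :=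
  ∃ g : (Fin n → ℝ) → ℝ, IsRegulous g ∧ ∀ x ∈ X, f x = g x

/-- The largest Zariski open subset of `X` on which `f` is regular. -/
def regularDomain {n : ℕ} (X : Set (Fin n → ℝ)) (f : (Fin n → ℝ) → ℝ) : Set (Fin n → ℝ) :=
  ⋃₀ {U | IsZariskiOpenIn X U ∧ IsRegularOnSet U f}

/-- The polar locus of `f` on `X`. -/
def polarLocus {n : ℕ} (X : Set (Fin n → ℝ)) (f : (Fin n → ℝ) → ℝ) : Set (Fin n → ℝ) :=
  X \ regularDomain X f

/-- The ideal of polynomials vanishing on `X`. -/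
noncomputable def vanishingIdealOf {n : ℕ} (X : Set (Fin n → ℝ)) : Ideal (MvPolynomial (Fin n) ℝ) where
  carrier := {p | ∀ x ∈ X, MvPolynomial.eval x p = 0}
  add_mem' := by
    intro a b ha hb x hx
    simp [map_add, ha x hx, hb x hx]
  zero_mem' := by intro x hx; simp
  smul_mem' := by
    intro c p hp x hx
    simp [smul_eq_mul, map_mul, hp x hx]

/-- The dimension of `X`: the Krull dimension of its coordinate ring. -/
noncomputable def algDim {n : ℕ} (X : Set (Fin n → ℝ)) : WithBot ℕ∞ :=
  ringKrullDim (MvPolynomial (Fin n) ℝ ⧸ vanishingIdealOf X)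

/-- `x` is a regular (nonsingular) point of `X`: locally around `x`, `X` is the common zero
set of `n - d` polynomials (`d = dim X`) whose gradients at `x` are linearly independent. -/
def IsRegularPoint {n : ℕ} (X : Set (Fin n → ℝ)) (x : Fin n → ℝ) : Prop :=
  x ∈ X ∧ ∃ d : ℕ, algDim X = (d : WithBot ℕ∞) ∧
    ∃ (p : Fin (n - d) → MvPolynomial (Fin n) ℝ) (U : Set (Fin n → ℝ)),
      IsOpen U ∧ x ∈ U ∧
      X ∩ U = {y ∈ U | ∀ j, MvPolynomial.eval y (p j) = 0} ∧
      LinearIndependent ℝ fun j : Fin (n - d) =>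
        fun i : Fin n => MvPolynomial.eval x (MvPolynomial.pderiv i (p j))

/-- `X` is central: it is the euclidean closure of its set of regular points. -/
def IsCentral {n : ℕ} (X : Set (Fin n → ℝ)) : Prop :=
  closure {x | IsRegularPoint X x} = X

/-- A semi-algebraic subset of `ℝᵐ`: a finite union of sets
`{x | p x = 0, q₁ x > 0, …, q_k x > 0}`. -/
def IsSemialgebraic {m : ℕ} (S : Set (Fin m → ℝ)) : Prop :=
  ∃ (N : ℕ) (P : Fin N → MvPolynomial (Fin m) ℝ) (k : Fin N → ℕ)
    (Q : (i : Fin N) → Fin (k i) → MvPolynomial (Fin m) ℝ),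
    S = ⋃ i, {x | MvPolynomial.eval x (P i) = 0 ∧ ∀ j, 0 < MvPolynomial.eval x (Q i j)}

/-- The graph of `f : X → ℝ`, as a subset of `ℝⁿ⁺¹`. -/
def graphOn {n : ℕ} (X : Set (Fin n → ℝ)) (f : (Fin n → ℝ) → ℝ) : Set (Fin (n + 1) → ℝ) :=
  {y | (fun i : Fin n => y i.castSucc) ∈ X ∧ y (Fin.last n) = f fun i : Fin n => y i.castSucc}

/-- `f` is a semi-algebraic function on `X`: its graph is semi-algebraic in `ℝⁿ⁺¹`. -/
def IsSemialgebraicFnOn {n : ℕ} (X : Set (Fin n → ℝ)) (f : (Fin n → ℝ) → ℝ) : Prop :=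
  IsSemialgebraic (graphOn X f)

/-- The interior of `S` in `X` for the euclidean topology of `X`. -/
def interiorIn {n : ℕ} (X S : Set (Fin n → ℝ)) : Set (Fin n → ℝ) :=
  {x ∈ X | ∃ U, IsOpen U ∧ x ∈ U ∧ U ∩ X ⊆ S}

/-- The euclidean boundary of `S` in `X`: closure of `S` in `X` minus interior of `S` in `X`. -/
def bdIn {n : ℕ} (X S : Set (Fin n → ℝ)) : Set (Fin n → ℝ) :=
  (closure S ∩ X) \ interiorIn X S

/-- The Zariski closure of `E` in `X`: the smallest real algebraic subset of `X`
containing `E`. -/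
def zarClosureIn {n : ℕ} (X E : Set (Fin n → ℝ)) : Set (Fin n → ℝ) :=
  ⋂₀ {V | IsZariskiClosedIn X V ∧ E ⊆ V}

/-- `V` is a regulous closed subset of `X`: the zero set of a regulous function on `X`. -/
def IsRegulousClosedIn {n : ℕ} (X V : Set (Fin n → ℝ)) : Prop :=
  ∃ f : (Fin n → ℝ) → ℝ, IsRegulousOn X f ∧ V = {x ∈ X | f x = 0}

/-- The regulous closure of `E` in `X`: the smallest regulous closed subset of `X`
containing `E`. -/
def regClosureIn {n : ℕ} (X E : Set (Fin n → ℝ)) : Set (Fin n → ℝ) :=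
  ⋂₀ {V | IsRegulousClosedIn X V ∧ E ⊆ V}

/-- `X` is an irreducible real algebraic set: it is not the union of two proper real
algebraic subsets. -/
def IsIrreducibleAlgSet {n : ℕ} (X : Set (Fin n → ℝ)) : Prop :=
  IsRealAlgebraicSet X ∧
    ∀ V W : Set (Fin n → ℝ), IsZariskiClosedIn X V → IsZariskiClosedIn X W →
      X = V ∪ W → V = X ∨ W = X


section Loj
set_option linter.unusedSectionVars false
variable {F : Type*} [Field F] [LinearOrder F] [IsStrictOrderedRing F]

/-- the convex subring attached to `d`. -/
def bigO (d : F) (h0 : 0 < d) (h1 : d ≤ 1 / 2) : Subring F where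
  carrier := {t | ∃ k : ℕ, |t| * d ^ k ≤ 1}
  mul_mem' := by
    rintro a b ⟨i, hi⟩ ⟨j, hj⟩
    refine ⟨i + j, ?_⟩
    rw [abs_mul, pow_add]
    calc |a| * |b| * (d ^ i * d ^ j) = (|a| * d ^ i) * (|b| * d ^ j) := by ring
      _ ≤ 1 * 1 := mul_le_mul hi hj (by positivity) zero_le_one
      _ = 1 := one_mul 1
  one_mem' := ⟨0, by simp⟩
  add_mem' := by
    rintro a b ⟨i, hi⟩ ⟨j, hj⟩
    refine ⟨i + j + 1, ?_⟩
    have hd1 : d ≤ 1 := h1.trans (by norm_num)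
    have e1 : |a| * d ^ (i + j) ≤ 1 := by
      rw [pow_add, ← mul_assoc]
      exact mul_le_one₀ hi (by positivity) (pow_le_one₀ h0.le hd1)
    have e2 : |b| * d ^ (i + j) ≤ 1 := by
      rw [add_comm, pow_add, ← mul_assoc]
      exact mul_le_one₀ hj (by positivity) (pow_le_one₀ h0.le hd1)
    calc |a + b| * d ^ (i + j + 1) ≤ (|a| + |b|) * d ^ (i + j + 1) := by
            gcongr; exact abs_add_le a b
      _ = (|a| * d ^ (i + j) + |b| * d ^ (i + j)) * d := by ring
      _ ≤ (1 + 1) * (1 / 2) := by gcongr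
      _ = 1 := by norm_num
  zero_mem' := ⟨0, by simp⟩
  neg_mem' := by
    rintro a ⟨i, hi⟩
    exact ⟨i, by rwa [abs_neg]⟩

/-- negligible elements -/
def Negl (d t : F) : Prop := ∀ k : ℕ, |t| ≤ d ^ k

variable {d : F} {h0 : 0 < d} {h1 : d ≤ 1 / 2}

lemma Negl.add (h0 : 0 < d) (h1 : d ≤ 1 / 2) {a b : F} (ha : Negl d a) (hb : Negl d b) : Negl d (a + b) := by
  intro k
  have e1 := ha (k + 1)
  have e2 := hb (k + 1)
  have : d ^ (k + 1) ≤ d ^ k * (1 / 2) := by rw [pow_succ]; gcongr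
  have := abs_add_le a b
  linarith

lemma Negl.neg {a : F} (ha : Negl d a) : Negl d (-a) := by
  intro k; rw [abs_neg]; exact ha k

lemma Negl.mul {a b : F} (ha : a ∈ bigO d h0 h1) (hb : Negl d b) : Negl d (a * b) := by
  obtain ⟨i, hi⟩ := ha
  intro k
  have := hb (i + k)
  rw [abs_mul]
  calc |a| * |b| ≤ |a| * d ^ (i + k) := by gcongr
    _ = (|a| * d ^ i) * d ^ k := by ring
    _ ≤ 1 * d ^ k := by gcongr
    _ = _ := one_mul _

lemma Negl.mem {a : F} (ha : Negl d a) : a ∈ bigO d h0 h1 := ⟨0, by simpa using ha 0⟩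

lemma inv_mem_bigO {a : F} (ha : ¬ Negl d a) : a⁻¹ ∈ bigO d h0 h1 := by
  unfold Negl at ha
  push Not at ha
  obtain ⟨k, hk⟩ := ha
  refine ⟨k, ?_⟩
  have : 0 < |a| := lt_trans (by positivity) hk
  rw [abs_inv, inv_mul_le_iff₀ this]
  linarith

lemma not_negl_of_inv_mem {a : F} (ha0 : a ≠ 0) (ha : a⁻¹ ∈ bigO d h0 h1) : ¬ Negl d a := by
  intro h
  have := Negl.mul ha h 1
  rw [inv_mul_cancel₀ ha0] at this
  simp at this
  linarith

lemma negl_zero (h0 : 0 < d) : Negl d (0 : F) := by intro k; simp; positivity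

lemma hensel_aux (ivt : ∀ (h : Polynomial F) (a b : F), a ≤ b → h.eval a ≤ 0 → 0 ≤ h.eval b →
      ∃ s, a ≤ s ∧ s ≤ b ∧ h.eval s = 0)
    (h : Polynomial (bigO d h0 h1)) (t : bigO d h0 h1)
    (ht : Negl d ((h.eval t : bigO d h0 h1) : F))
    (ht' : ¬ Negl d ((h.derivative.eval t : bigO d h0 h1) : F)) :
    ∃ s : F, (h.map (bigO d h0 h1).subtype).eval s = 0 ∧ Negl d (s - t) := by
  set A : F := ((h.eval t : bigO d h0 h1) : F) with hA
  set B : F := ((h.derivative.eval t : bigO d h0 h1) : F) with hB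
  have hB0 : B ≠ 0 := by
    intro hh; exact ht' (hh ▸ negl_zero h0)
  have hBinv : B⁻¹ ∈ bigO d h0 h1 := inv_mem_bigO ht'
  set r : F := 2 * |A / B| with hr
  have habs : ∀ u : F, Negl d u → Negl d |u| := by intro u hu k; rw [abs_abs]; exact hu k
  have hrN : Negl d r := by
    have e : Negl d (A / B) := by rw [div_eq_mul_inv, mul_comm]; exact Negl.mul hBinv ht
    have := habs _ e
    rw [hr, two_mul]; exact this.add h0 h1 this
  have hr0 : 0 ≤ r := by positivity
  have key : ∀ u : F, Negl d u → ∃ w : F, Negl d (w * u) ∧ w ∈ bigO d h0 h1 ∧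
      (h.map (bigO d h0 h1).subtype).eval (t + u) / B = A / B + u + u * (w * u) := by
    intro u hu
    obtain ⟨w, hw⟩ := h.binomExpansion t ⟨u, hu.mem⟩
    have e : (h.map (bigO d h0 h1).subtype).eval ((t : F) + u)
        = ((h.eval (t + ⟨u, hu.mem⟩) : bigO d h0 h1) : F) := by
      have := Polynomial.eval_map_apply (p := h) (f := (bigO d h0 h1).subtype) (x := t + ⟨u, hu.mem⟩)
      simpa using this
    refine ⟨w * B⁻¹, Negl.mul (mul_mem w.2 hBinv) hu, mul_mem w.2 hBinv, ?_⟩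
    rw [e, hw]
    push_cast
    rw [← hA, ← hB]
    field_simp
  obtain ⟨w1, hw1, _, e1⟩ := key r hrN
  obtain ⟨w2, hw2, _, e2⟩ := key (-r) hrN.neg
  have b1 : |w1 * r| ≤ 1 / 2 := (hw1 1).trans (by simpa using h1)
  have b2 : |w2 * (-r)| ≤ 1 / 2 := (hw2 1).trans (by simpa using h1)
  have p1 : 0 ≤ (h.map (bigO d h0 h1).subtype).eval (t + r) / B := by
    rw [e1]
    have : -(1/2) * r ≤ r * (w1 * r) := by
      have := (abs_le.1 b1).1; nlinarith
    have := neg_abs_le (A / B)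
    have : |A / B| = r / 2 := by rw [hr]; ring
    linarith
  have p2 : (h.map (bigO d h0 h1).subtype).eval (t + -r) / B ≤ 0 := by
    rw [e2]
    have : (-r) * (w2 * (-r)) ≤ (1/2) * r := by
      have := (abs_le.1 b2).1; nlinarith
    have := le_abs_self (A / B)
    have : |A / B| = r / 2 := by rw [hr]; ring
    linarith
  obtain ⟨s, hs1, hs2, hs⟩ := ivt (h.map (bigO d h0 h1).subtype * Polynomial.C B⁻¹) (t + -r) (t + r)
    (by linarith) (by simpa [div_eq_mul_inv] using p2) (by simpa [div_eq_mul_inv] using p1)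
  refine ⟨s, ?_, ?_⟩
  · simpa [hB0] using hs
  · intro k
    refine le_trans ?_ (hrN k)
    rw [abs_of_nonneg hr0, abs_le]
    constructor <;> linarith

open IntermediateField in
lemma exists_coeff_field {K : Type*} [Field K] [CharZero K] [Algebra K F]
    (ivt : ∀ (h : Polynomial F) (a b : F), a ≤ b → h.eval a ≤ 0 → 0 ≤ h.eval b →
      ∃ s, a ≤ s ∧ s ≤ b ∧ h.eval s = 0)
    (hK : ∀ c : K, algebraMap K F c ∈ bigO d h0 h1) :
    ∃ L : IntermediateField K F, (∀ a ∈ L, a ∈ bigO d h0 h1) ∧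
      ∀ t ∈ bigO d h0 h1, ∃ s ∈ L, Negl d (s - t) := by
  obtain ⟨L, hL⟩ : ∃ L : IntermediateField K F, Maximal (fun L => ∀ a ∈ L, a ∈ bigO d h0 h1) L := by
    apply zorn_le₀ {L : IntermediateField K F | ∀ a ∈ L, a ∈ bigO d h0 h1}
    intro c hc hch
    rcases c.eq_empty_or_nonempty with rfl | hne
    · refine ⟨⊥, ?_, by simp⟩
      intro a ha
      obtain ⟨x, rfl⟩ := IntermediateField.mem_bot.1 ha
      exact hK x
    · have : Nonempty c := hne.to_subtype
      refine ⟨⨆ i : c, (i : IntermediateField K F), ?_, fun z hz => le_iSup (fun i : c => (i : IntermediateField K F)) ⟨z, hz⟩⟩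
      intro a ha
      have hd : Directed (· ≤ ·) (fun i : c => (i : IntermediateField K F)) := hch.directed
      have : a ∈ ((⨆ i : c, (i : IntermediateField K F) : IntermediateField K F) : Set F) := ha
      rw [IntermediateField.coe_iSup_of_directed hd] at this
      obtain ⟨i, hi⟩ := Set.mem_iUnion.1 this
      exact hc i.2 a hi
  have hLO := hL.prop
  have hmax : ∀ s : F, (∀ a ∈ L⟮s⟯, a ∈ bigO d h0 h1) → s ∈ L := by
    intro s hs
    have h2 := hL.le_of_ge (y := (L⟮s⟯).restrictScalars K) (fun a ha => hs a ha)
      (fun a ha => (L⟮s⟯).algebraMap_mem ⟨a, ha⟩)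
    exact h2 (IntermediateField.mem_adjoin_simple_self L s)
  refine ⟨L, hLO, ?_⟩
  intro t ht
  let ι : L →+* bigO d h0 h1 := (algebraMap L F).codRestrict (bigO d h0 h1) (fun a => hLO a a.2)
  have hι : (bigO d h0 h1).subtype.comp ι = algebraMap L F := by ext; rfl
  have hev : ∀ (h : Polynomial L) (s : bigO d h0 h1), (((h.map ι).eval s : bigO d h0 h1) : F) = Polynomial.aeval (s : F) h := by
    intro h s
    have := Polynomial.eval_map_apply (p := h.map ι) (f := (bigO d h0 h1).subtype) (x := s)
    rw [Polynomial.map_map, hι] at this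
    rw [Polynomial.aeval_def, ← Polynomial.eval_map]
    exact this.symm
  have hevO : ∀ (h : Polynomial L) (s : F), s ∈ bigO d h0 h1 → Polynomial.aeval s h ∈ bigO d h0 h1 := by
    intro h s hs
    rw [← hev h ⟨s, hs⟩]; exact Subtype.mem _
  by_cases hcase : ∀ h : Polynomial L, h ≠ 0 → ¬ Negl d (Polynomial.aeval t h)
  · refine ⟨t, hmax t ?_, by simpa using negl_zero h0⟩
    intro a ha
    obtain ⟨r, s, rfl⟩ := (IntermediateField.mem_adjoin_simple_iff L a).1 ha
    rw [div_eq_mul_inv]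
    refine mul_mem (hevO _ _ ht) ?_
    by_cases hs : s = 0
    · simp [hs, zero_mem]
    · exact inv_mem_bigO (hcase s hs)
  · push Not at hcase
    classical
    obtain ⟨h, ⟨hh0, hhN⟩, hmin⟩ : ∃ h : Polynomial L, (h ≠ 0 ∧ Negl d (Polynomial.aeval t h)) ∧
        ∀ g : Polynomial L, (g ≠ 0 ∧ Negl d (Polynomial.aeval t g)) → h.natDegree ≤ g.natDegree := by
      have := WellFounded.has_min (measure (Polynomial.natDegree (R := L))).wf
        {h | h ≠ 0 ∧ Negl d (Polynomial.aeval t h)} hcase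
      obtain ⟨h, hh, hm⟩ := this
      exact ⟨h, hh, fun g hg => not_lt.1 (hm g hg)⟩
    have hdeg : h.natDegree ≠ 0 := by
      intro hd
      rw [Polynomial.eq_C_of_natDegree_eq_zero hd] at hhN hh0
      rw [Polynomial.aeval_C] at hhN
      have hc : h.coeff 0 ≠ 0 := by intro hc; apply hh0; rw [hc, Polynomial.C_0]
      refine not_negl_of_inv_mem (h0 := h0) (h1 := h1) (a := ((h.coeff 0 : L) : F)) ?_ ?_ hhN
      · simpa using hc
      · exact hLO _ (L.inv_mem (h.coeff 0).2)
    have hder : ¬ Negl d (Polynomial.aeval t h.derivative) := by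
      intro hN
      have h1' := hmin h.derivative ⟨?_, hN⟩
      · have := Polynomial.natDegree_derivative_lt hdeg
        omega
      · intro h0'
        have : CharZero L := charZero_of_injective_algebraMap (algebraMap K L).injective
        exact hdeg (Polynomial.derivative_eq_zero.1 h0')
    obtain ⟨s, hs, hst⟩ := hensel_aux ivt (h.map ι) ⟨t, ht⟩ (by rw [hev]; exact hhN)
      (by rw [Polynomial.derivative_map, hev]; exact hder)
    rw [Polynomial.map_map, hι, Polynomial.eval_map, ← Polynomial.aeval_def] at hs
    have hsO : s ∈ bigO d h0 h1 := by
      have := add_mem (hst.mem (h0 := h0) (h1 := h1)) ht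
      simpa using this
    refine ⟨s, hmax s ?_, hst⟩
    intro a ha
    have halg : IsAlgebraic L s := ⟨h, hh0, hs⟩
    rw [← IntermediateField.mem_toSubalgebra,
      IntermediateField.adjoin_simple_toSubalgebra_of_isAlgebraic halg,
      Algebra.adjoin_singleton_eq_range_aeval] at ha
    obtain ⟨g, rfl⟩ := ha
    exact hevO g s hsO

lemma approx_lift {K : Type*} [Field K] [CharZero K] [Algebra K F]
    (ivt : ∀ (h : Polynomial F) (a b : F), a ≤ b → h.eval a ≤ 0 → 0 ≤ h.eval b →
      ∃ s, a ≤ s ∧ s ≤ b ∧ h.eval s = 0)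
    (hK : ∀ c : K, algebraMap K F c ∈ bigO d h0 h1)
    {σ : Type*} (P : MvPolynomial σ K) (y : σ → F) (hy : ∀ i, y i ∈ bigO d h0 h1)
    (hP : Negl d (aeval y P)) : ∃ x : σ → F, aeval x P = 0 ∧ ∀ i, Negl d (x i - y i) := by
  obtain ⟨L, hLO, hL⟩ := exists_coeff_field (h0 := h0) (h1 := h1) ivt hK
  choose x hxL hx using fun i => hL (y i) (hy i)
  refine ⟨x, ?_, hx⟩
  have hmem : ∀ Q : MvPolynomial σ K, aeval x Q ∈ L := by
    intro Q
    induction Q using MvPolynomial.induction_on with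
    | C a => rw [aeval_C]; exact L.algebraMap_mem a
    | add p q hp hq => rw [map_add]; exact add_mem hp hq
    | mul_X p i hp => rw [map_mul, aeval_X]; exact mul_mem hp (hxL i)
  have hclose : ∀ Q : MvPolynomial σ K, Negl d (aeval x Q - aeval y Q) := by
    intro Q
    induction Q using MvPolynomial.induction_on with
    | C a => rw [aeval_C, aeval_C, sub_self]; exact negl_zero h0
    | add p q hp hq =>
      rw [map_add, map_add, add_sub_add_comm]; exact hp.add h0 h1 hq
    | mul_X p i hp =>
      rw [map_mul, map_mul, aeval_X, aeval_X]
      have : aeval x p * x i - aeval y p * y i = aeval x p * (x i - y i) + y i * (aeval x p - aeval y p) := by ring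
      rw [this]
      exact (Negl.mul (hLO _ (hmem p)) (hx i)).add h0 h1 (Negl.mul (hy i) hp)
  by_contra hne
  refine not_negl_of_inv_mem hne (hLO _ (L.inv_mem (hmem P))) ?_
  have := (hclose P).add h0 h1 hP
  simpa using this
end Loj

section Hyper
open Filter

abbrev HR : Type := Germ (hyperfilter ℕ : Filter ℕ) ℝ

noncomputable def hrc : ℝ →+* HR :=
  (Germ.coeRingHom (hyperfilter ℕ : Filter ℕ)).comp (Pi.constRingHom ℕ ℝ)

noncomputable instance hrAlg : Algebra ℝ HR := hrc.toAlgebra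

lemma hr_poly_rep (h : Polynomial HR) : ∃ H : ℕ → Polynomial ℝ, ∀ x : ℕ → ℝ,
    h.eval ((x : HR)) = ((fun k => (H k).eval (x k) : ℕ → ℝ) : HR) := by
  induction h using Polynomial.induction_on' with
  | add p q hp hq =>
    obtain ⟨H1, h1⟩ := hp
    obtain ⟨H2, h2⟩ := hq
    refine ⟨fun k => H1 k + H2 k, fun x => ?_⟩
    rw [Polynomial.eval_add, h1, h2, ← Germ.coe_add]
    congr 1
    funext k
    simp
  | monomial m a =>
    induction a using Germ.inductionOn with
    | h a =>
    refine ⟨fun k => Polynomial.monomial m (a k), fun x => ?_⟩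
    rw [Polynomial.eval_monomial, ← Germ.coe_pow, ← Germ.coe_mul]
    congr 1
    funext k
    simp

lemma hr_ivt (h : Polynomial HR) (a b : HR) (hab : a ≤ b) (ha : h.eval a ≤ 0) (hb : 0 ≤ h.eval b) :
    ∃ s, a ≤ s ∧ s ≤ b ∧ h.eval s = 0 := by
  obtain ⟨H, hH⟩ := hr_poly_rep h
  induction a using Germ.inductionOn with
  | h a =>
  induction b using Germ.inductionOn with
  | h b =>
  rw [hH] at ha hb
  have ha' : ∀ᶠ k in (hyperfilter ℕ : Filter ℕ), (H k).eval (a k) ≤ 0 := Germ.coe_le.1 ha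
  have hb' : ∀ᶠ k in (hyperfilter ℕ : Filter ℕ), 0 ≤ (H k).eval (b k) := Germ.coe_le.1 hb
  have hab' : ∀ᶠ k in (hyperfilter ℕ : Filter ℕ), a k ≤ b k := Germ.coe_le.1 hab
  have key : ∀ᶠ k in (hyperfilter ℕ : Filter ℕ), ∃ s, a k ≤ s ∧ s ≤ b k ∧ (H k).eval s = 0 := by
    filter_upwards [ha', hb', hab'] with k h1 h2 h3
    obtain ⟨s, hs, hs'⟩ := intermediate_value_Icc h3 (H k).continuous.continuousOn ⟨h1, h2⟩
    exact ⟨s, hs.1, hs.2, hs'⟩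
  obtain ⟨s, hs⟩ := key.choice
  refine ⟨(s : HR), Germ.coe_le.2 (hs.mono fun k hk => hk.1), Germ.coe_le.2 (hs.mono fun k hk => hk.2.1), ?_⟩
  rw [hH]
  exact Germ.coe_eq.2 (hs.mono fun k hk => hk.2.2)

lemma hr_aeval {σ : Type*} (P : MvPolynomial σ ℝ) (y : ℕ → σ → ℝ) :
    aeval (fun i => ((fun k => y k i : ℕ → ℝ) : HR)) P = ((fun k => eval (y k) P : ℕ → ℝ) : HR) := by
  induction P using MvPolynomial.induction_on with
  | C a => rw [aeval_C]; simp only [eval_C]; rfl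
  | add p q hp hq =>
    rw [map_add, hp, hq, ← Germ.coe_add]; congr 1; funext k; simp
  | mul_X p i hp =>
    rw [map_mul, hp, aeval_X, ← Germ.coe_mul]; congr 1; funext k; simp

/-- A global Łojasiewicz inequality. -/
theorem lojasiewicz {n : ℕ} (P : MvPolynomial (Fin n) ℝ) :
    ∃ N : ℕ, ∀ δ : ℝ, 0 < δ → δ ≤ 1 / 2 → ∀ y : Fin n → ℝ, (∀ i, |y i| * δ ≤ 1) →
      |eval y P| ≤ δ ^ N → ∃ x, eval x P = 0 ∧ ∀ i, |x i - y i| ≤ δ := by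
  by_contra hcon
  push Not at hcon
  choose δ h0 h1 y hy hP hbad using hcon
  set d : HR := ((δ : ℕ → ℝ) : HR) with hd
  have hd0 : 0 < d := Germ.coe_lt.2 (Eventually.of_forall h0)
  have hd1 : d ≤ 1 / 2 := by
    have e : ((1 : HR) / 2) = (((fun _ => 1 / 2 : ℕ → ℝ)) : HR) := rfl
    rw [e]; exact Germ.coe_le.2 (Eventually.of_forall h1)
  have habs : ∀ u : ℕ → ℝ, |((u : ℕ → ℝ) : HR)| = ((fun k => |u k| : ℕ → ℝ) : HR) := fun u => by
    rw [Germ.abs_def]; rfl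
  have hc : ∀ c : ℝ, algebraMap ℝ HR c ∈ bigO d hd0 hd1 := by
    intro c
    obtain ⟨m, hm⟩ := pow_unbounded_of_one_lt |c| (one_lt_two)
    refine ⟨m, ?_⟩
    have e : algebraMap ℝ HR c = (((fun _ => c : ℕ → ℝ)) : HR) := rfl
    rw [e, habs, hd, ← Germ.coe_pow, ← Germ.coe_mul]
    refine Germ.coe_le.2 (Eventually.of_forall fun k => ?_)
    show |c| * δ k ^ m ≤ 1
    calc |c| * δ k ^ m ≤ 2 ^ m * (1 / 2) ^ m := by
          gcongr
          · exact pow_nonneg (h0 k).le _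
          · exact (h0 k).le
          · exact h1 k
      _ = 1 := by rw [← mul_pow]; norm_num
  obtain ⟨x, hx0, hx⟩ := approx_lift (h0 := hd0) (h1 := hd1) hr_ivt hc P
    (fun i => ((fun k => y k i : ℕ → ℝ) : HR))
    (fun i => by
      refine ⟨1, ?_⟩
      rw [habs, pow_one, hd, ← Germ.coe_mul]
      exact Germ.coe_le.2 (Eventually.of_forall fun k => hy k i))
    (by
      intro m
      rw [hr_aeval, habs, hd, ← Germ.coe_pow]
      refine Germ.coe_le.2 ?_
      have : ∀ᶠ k in (hyperfilter ℕ : Filter ℕ), m ≤ k :=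
        Filter.Eventually.filter_mono Nat.hyperfilter_le_atTop (eventually_ge_atTop m)
      filter_upwards [this] with k hk
      refine (hP k).trans ?_
      exact pow_le_pow_of_le_one (h0 k).le ((h1 k).trans (by norm_num)) hk)
  choose X hX using fun i => Quotient.exists_rep (x i)
  have hX' : x = fun i => ((fun k => X i k : ℕ → ℝ) : HR) := by
    funext i; exact (hX i).symm
  rw [hX', hr_aeval P (fun k i => X i k)] at hx0
  have e1 : ∀ᶠ k in (hyperfilter ℕ : Filter ℕ), eval (fun i => X i k) P = 0 := Germ.coe_eq.1 hx0
  have e2 : ∀ᶠ k in (hyperfilter ℕ : Filter ℕ), ∀ i, |X i k - y k i| ≤ δ k := by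
    rw [eventually_all]
    intro i
    have := hx i 1
    rw [hX', ← Germ.coe_sub, habs, pow_one] at this
    exact Germ.coe_le.1 this
  obtain ⟨k, hk1, hk2⟩ := (e1.and e2).exists
  obtain ⟨i, hi⟩ := hbad k _ hk1
  exact absurd (hk2 i) (not_le.2 hi)

end Hyper

section Ext
open Filter Topology

lemma mvpoly_contDiff {n : ℕ} (p : MvPolynomial (Fin n) ℝ) {m : WithTop ℕ∞} :
    ContDiff ℝ m (fun x : Fin n → ℝ => eval x p) := by
  induction p using MvPolynomial.induction_on with
  | C a => simpa using contDiff_const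
  | add p q hp hq => simpa using hp.add hq
  | mul_X p i hp => simpa using hp.mul (contDiff_apply ℝ ℝ i)

lemma mvpoly_cont {n : ℕ} (p : MvPolynomial (Fin n) ℝ) :
    Continuous (fun x : Fin n → ℝ => eval x p) := (mvpoly_contDiff p (m := 0)).continuous

lemma mvpoly_lip {n : ℕ} (p : MvPolynomial (Fin n) ℝ) (z : Fin n → ℝ) :
    ∃ K : ℝ, 0 ≤ K ∧ ∃ r > 0, ∀ x y, dist x z < r → dist y z < r →
      |eval x p - eval y p| ≤ K * dist x y := by
  obtain ⟨K, t, ht, hK⟩ := (mvpoly_contDiff p (m := 1)).contDiffAt (x := z) |>.exists_lipschitzOnWith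
  obtain ⟨r, hr, hrt⟩ := Metric.mem_nhds_iff.1 ht
  refine ⟨K, K.2, r, hr, fun x y hx hy => ?_⟩
  have := hK.dist_le_mul x (hrt hx) y (hrt hy)
  rwa [Real.dist_eq] at this

set_option maxHeartbeats 1000000 in
theorem extend_step {n : ℕ} (P p q : MvPolynomial (Fin n) ℝ) (hP : ∀ x, 0 ≤ eval x P)
    (h : (Fin n → ℝ) → ℝ) (hc : ContinuousOn h {x | eval x P = 0})
    (hh : ∀ x, eval x P = 0 → h x * eval x q = eval x p)
    (h0 : ∀ x, eval x P = 0 → eval x q = 0 → h x = 0) :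
    ∃ F : (Fin n → ℝ) → ℝ, Continuous F ∧ (∀ x, eval x P = 0 → F x = h x) ∧
      ∃ a b : MvPolynomial (Fin n) ℝ, ∀ x, eval x P ≠ 0 → eval x b ≠ 0 ∧ F x = eval x a / eval x b := by
  obtain ⟨N, hN⟩ := lojasiewicz P
  set a : MvPolynomial (Fin n) ℝ := p * q ^ (2 * N + 1) with ha
  set b : MvPolynomial (Fin n) ℝ := q ^ (2 * N + 2) + P with hb
  have hae : ∀ x, eval x a = eval x p * eval x q ^ (2 * N + 1) := fun x => by simp [ha]
  have hbe : ∀ x, eval x b = eval x q ^ (2 * N + 2) + eval x P := fun x => by simp [hb]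
  have hqp : ∀ x, 0 ≤ eval x q ^ (2 * N + 2) := fun x => Even.pow_nonneg ⟨N + 1, by ring⟩ _
  have hqp2 : ∀ x, 0 ≤ eval x q ^ (2 * N) := fun x => Even.pow_nonneg ⟨N, by ring⟩ _
  have hbz : ∀ x, eval x b = 0 → eval x q = 0 ∧ eval x P = 0 := by
    intro x hx
    rw [hbe] at hx
    have h1 := hqp x
    have h2 := hP x
    have h3 : eval x q ^ (2 * N + 2) = 0 := by linarith
    exact ⟨pow_eq_zero_iff (by omega) |>.1 h3, by linarith⟩
  refine ⟨fun x => eval x a / eval x b, ?_, ?_, a, b, ?_⟩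
  · rw [continuous_iff_continuousAt]
    intro z
    by_cases hz : eval z b = 0
    · obtain ⟨hqz, hPz⟩ := hbz z hz
      have hFz : eval z a / eval z b = 0 := by rw [hz, div_zero]
      rw [Metric.continuousAt_iff', hFz]
      intro ε hε
      obtain ⟨K1, hK1, r1, hr1, l1⟩ := mvpoly_lip p z
      obtain ⟨K2, hK2, r2, hr2, l2⟩ := mvpoly_lip q z
      have hhz : h z = 0 := h0 z hPz hqz
      obtain ⟨r3, hr3, l3⟩ := Metric.continuousOn_iff.1 hc z hPz (ε / 4) (by linarith)
      set r := min r1 (min r2 r3) with hr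
      have hrp : 0 < r := lt_min hr1 (lt_min hr2 hr3)
      have cq : Tendsto (fun y => eval y q) (𝓝 z) (𝓝 0) := by
        have := (mvpoly_cont q).tendsto z; rwa [hqz] at this
      have cp : Tendsto (fun y => eval y p) (𝓝 z) (𝓝 (eval z p)) := (mvpoly_cont p).tendsto z
      have t1 : ∀ᶠ y in 𝓝 z, eval y q ^ 2 < min (r / 2) (1 / 2) := by
        have : Tendsto (fun y => eval y q ^ 2) (𝓝 z) (𝓝 0) := by simpa using cq.pow 2
        exact this.eventually_lt_const (lt_min (by linarith) (by norm_num))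
      have t2 : ∀ᶠ y in 𝓝 z, ∀ i, |y i| * eval y q ^ 2 < 1 := by
        rw [eventually_all]
        intro i
        have : Tendsto (fun y : Fin n → ℝ => |y i| * eval y q ^ 2) (𝓝 z) (𝓝 (|z i| * 0 ^ 2)) :=
          (((continuous_apply i).tendsto z).abs).mul (cq.pow 2)
        exact this.eventually_lt_const (by simp)
      have t3 : ∀ᶠ y in 𝓝 z, K1 * |eval y q| < ε / 4 := by
        have : Tendsto (fun y => K1 * |eval y q|) (𝓝 z) (𝓝 (K1 * |0|)) := cq.abs.const_mul K1
        exact this.eventually_lt_const (by simp; linarith)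
      have t4 : ∀ᶠ y in 𝓝 z, K2 * |eval y q| < 1 := by
        have : Tendsto (fun y => K2 * |eval y q|) (𝓝 z) (𝓝 (K2 * |0|)) := cq.abs.const_mul K2
        exact this.eventually_lt_const (by simp)
      have t5 : ∀ᶠ y in 𝓝 z, |eval y p| * |eval y q| < ε := by
        have : Tendsto (fun y => |eval y p| * |eval y q|) (𝓝 z) (𝓝 (|eval z p| * |0|)) :=
          cp.abs.mul cq.abs
        exact this.eventually_lt_const (by simp; linarith)
      filter_upwards [t1, t2, t3, t4, t5, Metric.ball_mem_nhds z (half_pos hrp)] with y e1 e2 e3 e4 e5 e6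
      rw [Real.dist_eq, sub_zero, hae, hbe]
      by_cases hqy : eval y q = 0
      · simp [hqy]; exact hε
      have hq2 : 0 < eval y q ^ 2 := by positivity
      have hden : 0 < eval y q ^ (2 * N + 2) := by
        rw [show 2 * N + 2 = 2 * (N + 1) by ring, pow_mul]; positivity
      have hden2 : 0 < eval y q ^ (2 * N) := by rw [pow_mul]; positivity
      have hPy := hP y
      rw [abs_div, abs_mul, abs_of_pos (add_pos_of_pos_of_nonneg hden hPy), abs_pow]
      have hodd : |eval y q| ^ (2 * N + 1) = |eval y q| * eval y q ^ (2 * N) := by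
        rw [pow_succ, pow_mul, sq_abs, ← pow_mul, mul_comm]
      by_cases hcase : eval y P ≤ (eval y q ^ 2) ^ N
      · obtain ⟨x, hx0, hx⟩ := hN (eval y q ^ 2) hq2 (e1.le.trans (min_le_right _ _)) y
          (fun i => (e2 i).le) (by rwa [abs_of_nonneg hPy])
        have hdxy : dist x y ≤ eval y q ^ 2 := (dist_pi_le_iff hq2.le).2 fun i => by
          rw [Real.dist_eq]; exact hx i
        have hyz : dist y z < r / 2 := e6
        have hxz : dist x z < r := by
          have := dist_triangle x y z
          have := lt_min_iff.1 e1
          linarith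
        have hyz' : dist y z < r := by linarith
        have rr1 : r ≤ r1 := min_le_left _ _
        have rr2 : r ≤ r2 := (min_le_right _ _).trans (min_le_left _ _)
        have rr3 : r ≤ r3 := (min_le_right _ _).trans (min_le_right _ _)
        have b1 := l1 y x (by linarith) (by linarith)
        have b2 := l2 x y (by linarith) (by linarith)
        have b3 : |h x| < ε / 4 := by
          have := l3 x hx0 (by linarith)
          rwa [hhz, Real.dist_eq, sub_zero] at this
        rw [dist_comm] at b1
        have b1' : |eval y p - eval x p| ≤ K1 * eval y q ^ 2 := b1.trans (by gcongr)
        have b2' : |eval x q - eval y q| ≤ K2 * eval y q ^ 2 := b2.trans (by gcongr)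
        have hsq : eval y q ^ 2 = |eval y q| * |eval y q| := by rw [abs_mul_abs_self, pow_two]
        have qpos : 0 < |eval y q| := abs_pos.2 hqy
        have b4 : |eval x q| ≤ 2 * |eval y q| := by
          have := abs_sub_abs_le_abs_sub (eval x q) (eval y q)
          rw [hsq] at b2'
          nlinarith
        have b5 : |eval x p| ≤ ε / 4 * (2 * |eval y q|) := by
          rw [← hh x hx0, abs_mul]
          gcongr
        have b6 : |eval y p| ≤ (3 * ε / 4) * |eval y q| := by
          have := abs_sub_abs_le_abs_sub (eval y p) (eval x p)
          rw [hsq] at b1'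
          nlinarith
        rw [div_lt_iff₀ (add_pos_of_pos_of_nonneg hden hPy), hodd]
        have hsplit : eval y q ^ (2 * N + 2) = |eval y q| * |eval y q| * eval y q ^ (2 * N) := by
          rw [← hsq, ← pow_add, add_comm]
        have c1 : |eval y p| * (|eval y q| * eval y q ^ (2 * N)) ≤
            (3 * ε / 4) * |eval y q| * (|eval y q| * eval y q ^ (2 * N)) := by gcongr
        have c2 : (3 * ε / 4) * |eval y q| * (|eval y q| * eval y q ^ (2 * N)) =
          (3 * ε / 4) * eval y q ^ (2 * N + 2) := by rw [hsplit]; ring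
        have c3 : 0 ≤ ε * eval y P := mul_nonneg hε.le hPy
        have c4 : 0 < ε * eval y q ^ (2 * N + 2) := mul_pos hε hden
        linarith
      · push Not at hcase
        rw [← pow_mul] at hcase
        rw [div_lt_iff₀ (add_pos_of_pos_of_nonneg hden hPy), hodd]
        calc |eval y p| * (|eval y q| * eval y q ^ (2 * N))
            = (|eval y p| * |eval y q|) * eval y q ^ (2 * N) := by ring
          _ < ε * eval y q ^ (2 * N) := by gcongr
          _ ≤ ε * (eval y q ^ (2 * N + 2) + eval y P) := by
            gcongr; linarith
    · exact ((mvpoly_cont a).continuousAt).div ((mvpoly_cont b).continuousAt) hz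
  · intro x hx
    show eval x a / eval x b = h x
    rw [hae, hbe, hx, add_zero, ← hh x hx]
    by_cases hq : eval x q = 0
    · rw [hq, h0 x hx hq]; simp
    · rw [div_eq_iff (pow_ne_zero _ hq)]; ring
  · intro x hx
    exact ⟨fun hbx => hx (hbz x hbx).2, rfl⟩

end Ext

section Curves
open Filter Topology

/-- total derivative of a polynomial along w -/
lemma mvpoly_hasFDerivAt {n : ℕ} (p : MvPolynomial (Fin n) ℝ) (x : Fin n → ℝ) :
    HasFDerivAt (fun x : Fin n → ℝ => eval x p)
      (∑ m, eval x (pderiv m p) • ContinuousLinearMap.proj (R := ℝ) (φ := fun _ : Fin n => ℝ) m) x := by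
  induction p using MvPolynomial.induction_on with
  | C a => simpa using hasFDerivAt_const a x
  | add p q hp hq =>
    have := hp.add hq
    simp only [map_add, add_smul, Finset.sum_add_distrib]
    exact this
  | mul_X p i hp =>
    have := hp.mul (hasFDerivAt_apply (𝕜 := ℝ) i x)
    simp only [map_mul, eval_X]
    refine this.congr_fderiv ?_
    ext w
    simp only [pderiv_mul, pderiv_X, map_add, map_mul, eval_X, sum_apply,
      smul_apply, ContinuousLinearMap.proj_apply, smul_eq_mul,
      add_apply, add_mul, Finset.sum_add_distrib, Finset.mul_sum]
    rw [add_comm]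
    congr 1
    · exact Finset.sum_congr rfl fun _ _ => by ring
    · symm
      rw [Finset.sum_eq_single i]
      · simp
      · intro b _ hb
        simp [Pi.single_apply, hb.symm]
      · simp

noncomputable def evPhi {n : ℕ} (Φ : Fin n → MvPolynomial (Fin n) ℝ) (x : Fin n → ℝ) : Fin n → ℝ :=
  fun a => eval x (Φ a)

noncomputable def jacM {n : ℕ} (Φ : Fin n → MvPolynomial (Fin n) ℝ) :
    Matrix (Fin n) (Fin n) (MvPolynomial (Fin n) ℝ) := fun a m => pderiv m (Φ a)

noncomputable def muP {n : ℕ} (Φ : Fin n → MvPolynomial (Fin n) ℝ) : MvPolynomial (Fin n) ℝ :=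
  (jacM Φ).det

noncomputable def DD {n : ℕ} (Φ : Fin n → MvPolynomial (Fin n) ℝ) (v : Fin n → ℝ)
    (g : MvPolynomial (Fin n) ℝ) : MvPolynomial (Fin n) ℝ :=
  ∑ a, C (v a) * ∑ m, (jacM Φ).adjugate m a * pderiv m g

lemma DD_key {n : ℕ} (Φ : Fin n → MvPolynomial (Fin n) ℝ) (v : Fin n → ℝ)
    (g : MvPolynomial (Fin n) ℝ) (x w : Fin n → ℝ)
    (hw : ∀ a, ∑ m, eval x (pderiv m (Φ a)) * w m = v a) :
    eval x (DD Φ v g) = eval x (muP Φ) * ∑ m, eval x (pderiv m g) * w m := by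
  have hadj : ∀ m m', ∑ a, eval x ((jacM Φ).adjugate m a) * eval x (pderiv m' (Φ a))
      = if m = m' then eval x (muP Φ) else 0 := by
    intro m m'
    have h := congrFun (congrFun (Matrix.adjugate_mul (jacM Φ)) m) m'
    rw [Matrix.mul_apply] at h
    have h2 := congrArg (eval x) h
    simp only [map_sum, map_mul, Matrix.smul_apply, Matrix.one_apply, smul_eq_mul, mul_ite, mul_one,
      mul_zero] at h2
    rw [show (∑ a, eval x ((jacM Φ).adjugate m a) * eval x (pderiv m' (Φ a))) =
      ∑ a, eval x ((jacM Φ).adjugate m a) * eval x (jacM Φ a m') from rfl, h2]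
    split_ifs <;> simp [muP]
  simp only [DD, map_sum, map_mul, eval_C]
  calc _ = ∑ a, ∑ m, ∑ m', (eval x ((jacM Φ).adjugate m a) * eval x (pderiv m' (Φ a))) *
          (eval x (pderiv m g) * w m') := by
        refine Finset.sum_congr rfl fun a _ => ?_
        rw [← hw a, Finset.mul_sum]
        refine Finset.sum_congr rfl fun m _ => ?_
        rw [Finset.sum_mul]
        exact Finset.sum_congr rfl fun _ _ => by ring
    _ = ∑ m, ∑ m', (∑ a, eval x ((jacM Φ).adjugate m a) * eval x (pderiv m' (Φ a))) *
          (eval x (pderiv m g) * w m') := by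
        rw [Finset.sum_comm]
        refine Finset.sum_congr rfl fun m _ => ?_
        rw [Finset.sum_comm]
        exact Finset.sum_congr rfl fun m' _ => by rw [Finset.sum_mul]
    _ = _ := by
        simp only [hadj, ite_mul, zero_mul, Finset.sum_ite_eq, Finset.mem_univ, if_true,
          Finset.mul_sum]

lemma DD_const_mul {n : ℕ} (Φ : Fin n → MvPolynomial (Fin n) ℝ) (v : Fin n → ℝ) : DD Φ v 0 = 0 := by
  simp [DD]

structure Par {n : ℕ} (Φ : Fin n → MvPolynomial (Fin n) ℝ) (y : Fin n → ℝ)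
    (ψ : (Fin n → ℝ) → (Fin n → ℝ)) : Prop where
  an : AnalyticAt ℝ ψ (evPhi Φ y)
  base : ψ (evPhi Φ y) = y
  ri : ∀ᶠ t in 𝓝 (evPhi Φ y), evPhi Φ (ψ t) = t
  li : ∀ᶠ x in 𝓝 y, ψ (evPhi Φ x) = x
  mu : eval y (muP Φ) ≠ 0

lemma evPhi_cont {n : ℕ} (Φ : Fin n → MvPolynomial (Fin n) ℝ) : Continuous (evPhi Φ) :=
  continuous_pi fun a => mvpoly_cont (Φ a)

lemma exists_par {n : ℕ} (Φ : Fin n → MvPolynomial (Fin n) ℝ) (y : Fin n → ℝ)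
    (hy : eval y (muP Φ) ≠ 0) : ∃ ψ, Par Φ y ψ := by
  set M : Matrix (Fin n) (Fin n) ℝ := (jacM Φ).map (eval y) with hM
  have hdet : IsUnit M.det := by
    have : M.det = eval y (muP Φ) := by
      rw [muP, hM, RingHom.map_det]; rfl
    rw [this]; exact isUnit_iff_ne_zero.2 hy
  let e : (Fin n → ℝ) ≃L[ℝ] (Fin n → ℝ) :=
    (Matrix.toLin'OfInv (M := M⁻¹) (M' := M) (Matrix.nonsing_inv_mul M hdet)
      (Matrix.mul_nonsing_inv M hdet)).toContinuousLinearEquiv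
  have hcd : ContDiffAt ℝ (⊤ : WithTop ℕ∞) (evPhi Φ) y :=
    (contDiff_pi.2 fun a => mvpoly_contDiff (Φ a)).contDiffAt
  have hfd : HasFDerivAt (evPhi Φ) (e : (Fin n → ℝ) →L[ℝ] (Fin n → ℝ)) y := by
    rw [hasFDerivAt_pi']
    intro a
    refine (mvpoly_hasFDerivAt (Φ a) y).congr_fderiv ?_
    ext w
    simp [e, Matrix.mulVec, dotProduct, hM, jacM]
  have h0 : (⊤ : WithTop ℕ∞) ≠ 0 := by simp
  have hs := hcd.hasStrictFDerivAt' hfd h0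
  refine ⟨hs.localInverse _ _ _, ?_, ?_, hs.eventually_right_inverse, hs.eventually_left_inverse, hy⟩
  · have := hcd.to_localInverse hfd h0
    exact this.analyticAt
  · exact hs.localInverse_apply_image

variable {n : ℕ} {Φ : Fin n → MvPolynomial (Fin n) ℝ} {y : Fin n → ℝ} {ψ : (Fin n → ℝ) → (Fin n → ℝ)}

lemma Par.deriv (h : Par Φ y ψ) : ∀ᶠ s in 𝓝 (evPhi Φ y), eval (ψ s) (muP Φ) ≠ 0 ∧
    ∀ (v c : Fin n → ℝ) (t : ℝ) (g : MvPolynomial (Fin n) ℝ), c + t • v = s →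
    HasDerivAt (fun τ : ℝ => eval (ψ (c + τ • v)) g)
      (eval (ψ s) (DD Φ v g) / eval (ψ s) (muP Φ)) t := by
  have hmu : ∀ᶠ s in 𝓝 (evPhi Φ y), eval (ψ s) (muP Φ) ≠ 0 := by
    have hc : ContinuousAt (fun s => eval (ψ s) (muP Φ)) (evPhi Φ y) :=
      (mvpoly_cont (muP Φ)).continuousAt.comp h.an.continuousAt
    apply hc.eventually_ne
    rw [h.base]; exact h.mu
  filter_upwards [hmu, h.an.eventually_analyticAt, h.ri.eventually_nhds] with s h1 h2 h3
  refine ⟨h1, fun v c t g hs => ?_⟩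
  have hl : HasDerivAt (fun τ : ℝ => c + τ • v) v t := by
    simpa using ((hasDerivAt_id t).smul_const v).const_add c
  have hψ : HasFDerivAt ψ (fderiv ℝ ψ s) (c + t • v) := by
    rw [hs]; exact h2.differentiableAt.hasFDerivAt
  set w := fderiv ℝ ψ s v
  have hγ : HasDerivAt (fun τ : ℝ => ψ (c + τ • v)) w t := hψ.comp_hasDerivAt t hl
  have hg : ∀ g : MvPolynomial (Fin n) ℝ, HasDerivAt (fun τ : ℝ => eval (ψ (c + τ • v)) g)
      (∑ m, eval (ψ s) (pderiv m g) * w m) t := by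
    intro g
    have := (mvpoly_hasFDerivAt g (ψ (c + t • v))).comp_hasDerivAt t hγ
    rw [hs] at this
    refine this.congr_deriv ?_
    simp
  have hw : ∀ a, ∑ m, eval (ψ s) (pderiv m (Φ a)) * w m = v a := by
    intro a
    refine (hg (Φ a)).unique ?_
    have h4 : HasDerivAt (fun τ : ℝ => (c + τ • v) a) (v a) t := (hasDerivAt_pi.1 hl) a
    refine h4.congr_of_eventuallyEq ?_
    have h5 : Tendsto (fun τ : ℝ => c + τ • v) (𝓝 t) (𝓝 s) := by
      rw [← hs]; exact hl.continuousAt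
    filter_upwards [h5.eventually h3] with τ hτ
    exact congrFun hτ a
  rw [DD_key Φ v g (ψ s) w hw, mul_div_cancel_left₀ _ h1]
  exact hg g

lemma line_tendsto (c v : Fin n → ℝ) : Tendsto (fun t : ℝ => c + t • v) (𝓝 0) (𝓝 c) := by
  have : Continuous (fun t : ℝ => c + t • v) := by fun_prop
  simpa using this.tendsto 0

lemma Par.cont (h : Par Φ y ψ) (v : Fin n → ℝ) (g : MvPolynomial (Fin n) ℝ) :
    Tendsto (fun t : ℝ => eval (ψ (evPhi Φ y + t • v)) g) (𝓝 0) (𝓝 (eval y g)) := by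
  have hc : Tendsto (fun s => eval (ψ s) g) (𝓝 (evPhi Φ y)) (𝓝 (eval y g)) := by
    have := (mvpoly_cont g).continuousAt.comp (x := evPhi Φ y) h.an.continuousAt
    have h2 := this.tendsto
    simp only [Function.comp_apply, h.base] at h2
    exact h2
  exact hc.comp (line_tendsto _ v)

lemma Par.lhop (h : Par Φ y ψ) (v : Fin n → ℝ) (j : ℕ) : ∀ g : MvPolynomial (Fin n) ℝ,
    (∀ i < j, eval y ((DD Φ v)^[i] g) = 0) →
    Tendsto (fun t : ℝ => eval (ψ (evPhi Φ y + t • v)) g / t ^ j) (𝓝[≠] 0)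
      (𝓝 (eval y ((DD Φ v)^[j] g) / (j.factorial * eval y (muP Φ) ^ j))) := by
  induction j with
  | zero => intro g _; simpa using (h.cont v g).mono_left nhdsWithin_le_nhds
  | succ j ih =>
    intro g hg
    have ih' := ih (DD Φ v g) (fun i hi => by
      rw [← Function.iterate_succ_apply]; exact hg _ (by omega))
    have hd := (line_tendsto (evPhi Φ y) v).eventually h.deriv
    refine HasDerivAt.lhopital_zero_nhdsNE
      (f' := fun t => eval (ψ (evPhi Φ y + t • v)) (DD Φ v g) / eval (ψ (evPhi Φ y + t • v)) (muP Φ))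
      (g' := fun t => ((j+1 : ℕ) : ℝ) * t ^ j) ?_ ?_ ?_ ?_ ?_ ?_
    · filter_upwards [hd.filter_mono nhdsWithin_le_nhds] with t ht
      exact ht.2 v _ t g rfl
    · refine Eventually.of_forall fun t => ?_
      simpa using hasDerivAt_pow (j+1) t
    · filter_upwards [self_mem_nhdsWithin] with t ht
      have : t ≠ 0 := ht
      positivity
    · have h0 : eval y g = 0 := by simpa using hg 0 (by omega)
      have := (h.cont v g).mono_left (nhdsWithin_le_nhds (s := {0}ᶜ))
      rwa [h0] at this
    · have : Continuous (fun t : ℝ => t ^ (j+1)) := by fun_prop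
      simpa using (this.tendsto 0).mono_left (nhdsWithin_le_nhds (s := {0}ᶜ))
    · have hm := (h.cont v (muP Φ)).mono_left (nhdsWithin_le_nhds (s := {0}ᶜ))
      have h2 := ih'.div (hm.const_mul ((j+1 : ℕ) : ℝ)) (mul_ne_zero (by positivity) h.mu)
      have e1 : eval y ((DD Φ v)^[j] (DD Φ v g)) / (j.factorial * eval y (muP Φ) ^ j) /
          (((j+1:ℕ):ℝ) * eval y (muP Φ)) = eval y ((DD Φ v)^[j+1] g) /
          ((j+1).factorial * eval y (muP Φ) ^ (j+1)) := by
        rw [Function.iterate_succ_apply, div_div, Nat.factorial_succ]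
        push_cast; congr 1; ring
      rw [e1] at h2
      refine h2.congr fun t => ?_
      simp only [div_div, Pi.div_apply]
      congr 1; ring

lemma Par.an_comp (h : Par Φ y ψ) (g : MvPolynomial (Fin n) ℝ) :
    AnalyticAt ℝ (fun s => eval (ψ s) g) (evPhi Φ y) := by
  have h1 : AnalyticAt ℝ (fun x : Fin n → ℝ => eval x g) (ψ (evPhi Φ y)) :=
    (mvpoly_contDiff g (m := ⊤)).contDiffAt.analyticAt
  exact h1.comp h.an

lemma line_an (c v : Fin n → ℝ) (t : ℝ) : AnalyticAt ℝ (fun t : ℝ => c + t • v) t := by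
  have : ContDiff ℝ ⊤ (fun t : ℝ => c + t • v) := by fun_prop
  exact this.contDiffAt.analyticAt

lemma Par.zero_line (h : Par Φ y ψ) (v : Fin n → ℝ) (g : MvPolynomial (Fin n) ℝ)
    (hg : ∀ j, eval y ((DD Φ v)^[j] g) = 0) :
    ∀ᶠ t : ℝ in 𝓝 0, eval (ψ (evPhi Φ y + t • v)) g = 0 := by
  have han : AnalyticAt ℝ (fun t : ℝ => eval (ψ (evPhi Φ y + t • v)) g) 0 := by
    refine AnalyticAt.fun_comp (g := fun s => eval (ψ s) g) ?_ (line_an _ v 0)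
    simpa using h.an_comp g
  by_contra hne
  obtain ⟨j, H, hH, hH0, he⟩ := (han.exists_eventuallyEq_pow_smul_nonzero_iff).2 hne
  have h1 := h.lhop v j g (fun i _ => hg i)
  rw [hg j, zero_div] at h1
  have h2 : Tendsto (fun t : ℝ => eval (ψ (evPhi Φ y + t • v)) g / t ^ j) (𝓝[≠] 0) (𝓝 (H 0)) := by
    refine (hH.continuousAt.tendsto.mono_left (nhdsWithin_le_nhds (s := {0}ᶜ))).congr' ?_
    filter_upwards [he.filter_mono nhdsWithin_le_nhds, self_mem_nhdsWithin] with t ht ht0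
    have : t ≠ 0 := ht0
    rw [ht]; simp; field_simp
  exact hH0 (tendsto_nhds_unique h2 h1)

end Curves

section Germ
open Filter Topology

variable {n : ℕ} {Φ : Fin n → MvPolynomial (Fin n) ℝ} {y : Fin n → ℝ} {ψ : (Fin n → ℝ) → (Fin n → ℝ)}

noncomputable def piK (K : Finset (Fin n)) (v : Fin n → ℝ) : Fin n → ℝ :=
  fun a => if a ∈ K then 0 else v a

lemma piK_contDiff (K : Finset (Fin n)) {m : WithTop ℕ∞} : ContDiff ℝ m (piK K) := by
  refine contDiff_pi.2 fun a => ?_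
  by_cases ha : a ∈ K
  · simpa [piK, ha] using contDiff_const
  · simpa [piK, ha] using contDiff_apply ℝ ℝ a

lemma piK_zero (K : Finset (Fin n)) : piK K 0 = 0 := by
  ext a; simp [piK]

lemma piK_tendsto (K : Finset (Fin n)) : Tendsto (piK K) (𝓝 0) (𝓝 0) := by
  simpa [piK_zero] using ((piK_contDiff K (m := 0)).continuous.tendsto 0)

lemma piK_add (K : Finset (Fin n)) (s v : Fin n → ℝ) (t : ℝ) (hv : ∀ a ∈ K, v a = 0) :
    piK K (s + t • v) = piK K s + t • v := by
  ext a
  by_cases ha : a ∈ K <;> simp [piK, ha, hv]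

lemma piK_self (K : Finset (Fin n)) (v : Fin n → ℝ) (hv : ∀ a ∈ K, v a = 0) : piK K v = v := by
  ext a
  by_cases ha : a ∈ K <;> simp [piK, ha, hv]

lemma piK_mem (K : Finset (Fin n)) (v : Fin n → ℝ) : ∀ a ∈ K, piK K v a = 0 := by
  intro a ha; simp [piK, ha]

lemma add_piK_tendsto (c : Fin n → ℝ) (K : Finset (Fin n)) :
    Tendsto (fun v => c + piK K v) (𝓝 0) (𝓝 c) := by
  simpa using (piK_tendsto K).const_add c

def GI (Φ : Fin n → MvPolynomial (Fin n) ℝ) (y : Fin n → ℝ) (ψ : (Fin n → ℝ) → (Fin n → ℝ))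
    (K : Finset (Fin n)) : Ideal (MvPolynomial (Fin n) ℝ) where
  carrier := {g | ∀ᶠ v in 𝓝 (0 : Fin n → ℝ), eval (ψ (evPhi Φ y + piK K v)) g = 0}
  add_mem' := by
    intro a b ha hb
    simp only [mem_setOf_eq] at *
    filter_upwards [ha, hb] with v h1 h2
    simp [h1, h2]
  zero_mem' := by simp
  smul_mem' := by
    intro c a ha
    simp only [mem_setOf_eq] at *
    filter_upwards [ha] with v h1
    simp [h1]

lemma mem_GI {K : Finset (Fin n)} {g : MvPolynomial (Fin n) ℝ} : g ∈ GI Φ y ψ K ↔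
    ∀ᶠ v in 𝓝 (0 : Fin n → ℝ), eval (ψ (evPhi Φ y + piK K v)) g = 0 := Iff.rfl

lemma Par.an_piK (h : Par Φ y ψ) (K : Finset (Fin n)) (g : MvPolynomial (Fin n) ℝ) :
    AnalyticAt ℝ (fun v => eval (ψ (evPhi Φ y + piK K v)) g) 0 := by
  have h1 : AnalyticAt ℝ (fun v => evPhi Φ y + piK K v) 0 :=
    (contDiff_const.add (piK_contDiff K (m := ⊤))).contDiffAt.analyticAt
  refine AnalyticAt.fun_comp (g := fun s => eval (ψ s) g) ?_ h1
  simpa [piK_zero] using h.an_comp g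

lemma GI_eval (h : Par Φ y ψ) {K : Finset (Fin n)} {g : MvPolynomial (Fin n) ℝ}
    (hg : g ∈ GI Φ y ψ K) : eval y g = 0 := by
  have := (mem_GI.1 hg).self_of_nhds
  simpa [piK_zero, h.base] using this

lemma GI_prime (h : Par Φ y ψ) (K : Finset (Fin n)) : (GI Φ y ψ K).IsPrime := by
  rw [Ideal.isPrime_iff]
  refine ⟨fun htop => ?_, fun {g k} hgk => ?_⟩
  · have h1 : (1 : MvPolynomial (Fin n) ℝ) ∈ GI Φ y ψ K := by rw [htop]; trivial
    simpa using GI_eval h h1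
  · by_contra! hcon
    obtain ⟨hg, hk⟩ := hcon
    obtain ⟨r, hr, hb⟩ := Metric.eventually_nhds_iff_ball.1
      (((h.an_piK K g).eventually_analyticAt.and (h.an_piK K k).eventually_analyticAt).and
        (mem_GI.1 hgk))
    have hpre : IsPreconnected (Metric.ball (0 : Fin n → ℝ) r) :=
      (convex_ball _ _).isPreconnected
    have : ∃ w ∈ Metric.ball (0 : Fin n → ℝ) r, eval (ψ (evPhi Φ y + piK K w)) g ≠ 0 := by
      by_contra! hz
      exact hg (mem_GI.2 (Metric.eventually_nhds_iff_ball.2 ⟨r, hr, hz⟩))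
    obtain ⟨w, hw, hgw⟩ := this
    have hne := (hb w hw).1.1.continuousAt.eventually_ne hgw
    have hkz : (fun v => eval (ψ (evPhi Φ y + piK K v)) k) =ᶠ[𝓝 w] 0 := by
      filter_upwards [hne, Metric.isOpen_ball.mem_nhds hw] with v hv hvb
      have := (hb v hvb).2
      rw [map_mul] at this
      exact (mul_eq_zero.1 this).resolve_left hv
    have hE := AnalyticOnNhd.eqOn_zero_of_preconnected_of_eventuallyEq_zero
      (f := fun v => eval (ψ (evPhi Φ y + piK K v)) k)
      (fun v hv => (hb v hv).1.2) hpre hw hkz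
    exact hk (mem_GI.2 (Metric.eventually_nhds_iff_ball.2 ⟨r, hr, fun v hv => hE hv⟩))

lemma GI_mono {K K' : Finset (Fin n)} (hK : K ⊆ K') : GI Φ y ψ K ≤ GI Φ y ψ K' := by
  intro g hg
  have := (piK_tendsto K').eventually (mem_GI.1 hg)
  refine mem_GI.2 ?_
  filter_upwards [this] with v hv
  rwa [piK_self K _ (fun a ha => piK_mem K' v a (hK ha))] at hv

lemma GI_mem_insert (h : Par Φ y ψ) {K : Finset (Fin n)} {a : Fin n} (ha : a ∈ K) :
    Φ a - C (evPhi Φ y a) ∈ GI Φ y ψ K := by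
  refine mem_GI.2 ?_
  filter_upwards [(add_piK_tendsto (evPhi Φ y) K).eventually h.ri] with v hv
  have := congrFun hv a
  simp only [evPhi, Pi.add_apply, piK, ha, if_true, add_zero] at this
  simp only [map_sub, eval_C]
  rw [sub_eq_zero]
  exact this

lemma GI_not_mem (h : Par Φ y ψ) {K : Finset (Fin n)} {a : Fin n} (ha : a ∉ K) :
    Φ a - C (evPhi Φ y a) ∉ GI Φ y ψ K := by
  intro hmem
  have h1 := (mem_GI.1 hmem).and ((add_piK_tendsto (evPhi Φ y) K).eventually h.ri)
  have h2 : Tendsto (fun t : ℝ => (0 : Fin n → ℝ) + t • Pi.single a (1 : ℝ)) (𝓝[≠] 0) (𝓝 0) :=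
    (line_tendsto _ _).mono_left nhdsWithin_le_nhds
  have h3 := (h2.eventually h1).and self_mem_nhdsWithin
  obtain ⟨t, ⟨ht1, ht2⟩, ht⟩ := h3.exists
  have := congrFun ht2 a
  simp only [map_sub, eval_C] at ht1
  rw [sub_eq_zero] at ht1
  have h4 : evPhi Φ (ψ (evPhi Φ y + piK K (0 + t • Pi.single a 1))) a = evPhi Φ y a := ht1
  rw [h4] at this
  simp [piK, ha] at this
  exact ht this

lemma GI_stable (h : Par Φ y ψ) {K : Finset (Fin n)} {g : MvPolynomial (Fin n) ℝ}
    (hg : g ∈ GI Φ y ψ K) {v : Fin n → ℝ} (hv : ∀ a ∈ K, v a = 0) : DD Φ v g ∈ GI Φ y ψ K := by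
  refine mem_GI.2 ?_
  filter_upwards [(add_piK_tendsto (evPhi Φ y) K).eventually h.deriv, (mem_GI.1 hg).eventually_nhds]
    with s h1 h2
  have hd := h1.2 v (evPhi Φ y + piK K s) 0 g (by simp)
  have h3 := (line_tendsto s v).eventually h2
  have hz : HasDerivAt (fun τ : ℝ => eval (ψ (evPhi Φ y + piK K s + τ • v)) g) 0 0 := by
    refine (hasDerivAt_const (0 : ℝ) (0 : ℝ)).congr_of_eventuallyEq ?_
    filter_upwards [h3] with t ht
    rwa [piK_add K s v t hv, ← add_assoc] at ht
  have := hd.unique hz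
  exact (div_eq_zero_iff.1 this).resolve_right h1.1

lemma GI_stable_iter (h : Par Φ y ψ) {K : Finset (Fin n)} {g : MvPolynomial (Fin n) ℝ}
    (hg : g ∈ GI Φ y ψ K) {v : Fin n → ℝ} (hv : ∀ a ∈ K, v a = 0) (j : ℕ) :
    (DD Φ v)^[j] g ∈ GI Φ y ψ K := by
  induction j with
  | zero => exact hg
  | succ j ih => rw [Function.iterate_succ_apply']; exact GI_stable h ih hv

lemma GI_of_DD (h : Par Φ y ψ) {K : Finset (Fin n)} {g : MvPolynomial (Fin n) ℝ}
    (hg : ∀ v : Fin n → ℝ, (∀ a ∈ K, v a = 0) → ∀ j, eval y ((DD Φ v)^[j] g) = 0) :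
    g ∈ GI Φ y ψ K := by
  obtain ⟨r, hr, hb⟩ := Metric.eventually_nhds_iff_ball.1 (h.an_piK K g).eventually_analyticAt
  refine mem_GI.2 (Metric.eventually_nhds_iff_ball.2 ⟨r, hr, fun w hw => ?_⟩)
  have hz := h.zero_line (piK K w) g (hg _ (piK_mem K w))
  have hseg : ∀ t ∈ Icc (0:ℝ) 1, (0 : Fin n → ℝ) + t • w ∈ Metric.ball (0 : Fin n → ℝ) r := by
    intro t ht
    simp only [zero_add, mem_ball_zero_iff, norm_smul] at *
    calc ‖t‖ * ‖w‖ ≤ 1 * ‖w‖ := by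
          gcongr; rw [Real.norm_eq_abs, abs_of_nonneg ht.1]; exact ht.2
      _ < r := by simpa using hw
  have hA : AnalyticOnNhd ℝ (fun t : ℝ => eval (ψ (evPhi Φ y + piK K (0 + t • w))) g) (Icc 0 1) := by
    intro t ht
    exact AnalyticAt.fun_comp (g := fun v => eval (ψ (evPhi Φ y + piK K v)) g) (hb _ (hseg t ht))
      (line_an 0 w t)
  have hp : ∀ t : ℝ, piK K (0 + t • w) = t • piK K w := by
    intro t; ext a; by_cases ha : a ∈ K <;> simp [piK, ha]
  have hE := AnalyticOnNhd.eqOn_zero_of_preconnected_of_eventuallyEq_zero hA isPreconnected_Icc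
    (z₀ := 0) (by simp) (by
      filter_upwards [hz] with t ht
      rw [hp]; exact ht)
  have := hE (show (1:ℝ) ∈ Icc (0:ℝ) 1 by simp)
  simpa using this

lemma GI_coheight (h : Par Φ y ψ) (I : Ideal (MvPolynomial (Fin n) ℝ)) (m : ℕ) :
    ∀ (K : Finset (Fin n)), K.card + m = n →
    ∀ x : PrimeSpectrum.zeroLocus (I : Set (MvPolynomial (Fin n) ℝ)),
      x.1.asIdeal = GI Φ y ψ K → (m : ℕ∞) ≤ Order.coheight x := by
  induction m with
  | zero => intro K _ x _; simp
  | succ m ih =>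
    intro K hK x hx
    obtain ⟨a, ha⟩ : ∃ a, a ∉ K := by
      by_contra! hall
      have : K = Finset.univ := Finset.eq_univ_of_forall hall
      rw [this] at hK; simp at hK
    have hle : GI Φ y ψ K ≤ GI Φ y ψ (insert a K) := GI_mono (Finset.subset_insert _ _)
    have hxI : I ≤ x.1.asIdeal := x.2
    let x' : PrimeSpectrum.zeroLocus (I : Set (MvPolynomial (Fin n) ℝ)) :=
      ⟨⟨GI Φ y ψ (insert a K), GI_prime h _⟩, (hxI.trans hx.le).trans hle⟩
    have hlt : x < x' := by
      rw [← Subtype.coe_lt_coe, ← PrimeSpectrum.asIdeal_lt_asIdeal]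
      refine lt_of_le_of_ne (hx.le.trans hle) fun heq => ?_
      have h1 := GI_mem_insert h (K := insert a K) (Finset.mem_insert_self a K)
      have h2 : Φ a - C (evPhi Φ y a) ∈ x.1.asIdeal := by rw [heq]; exact h1
      rw [hx] at h2
      exact GI_not_mem h ha h2
    have h3 := ih (insert a K) (by rw [Finset.card_insert_of_notMem ha]; omega) x' rfl
    calc ((m+1 : ℕ) : ℕ∞) = m + 1 := by push_cast; rfl
      _ ≤ Order.coheight x' + 1 := by gcongr
      _ ≤ _ := Order.coheight_add_one_le hlt

lemma algDim_le (X : Set (Fin n → ℝ)) : algDim X ≤ n := by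
  refine (ringKrullDim_quotient_le _).trans ?_
  rw [MvPolynomial.ringKrullDim_of_isNoetherianRing]
  simp

lemma GI_minimal (h : Par Φ y ψ) {X : Set (Fin n → ℝ)} {d : ℕ} (hd : algDim X = d)
    {K : Finset (Fin n)} (hK : K.card = n - d) (hle : vanishingIdealOf X ≤ GI Φ y ψ K) :
    GI Φ y ψ K ∈ (vanishingIdealOf X).minimalPrimes := by
  have hdn : d ≤ n := by
    have := algDim_le X
    rw [hd] at this
    exact_mod_cast this
  refine ⟨⟨GI_prime h K, hle⟩, fun q hq hqle => ?_⟩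
  by_contra hne
  let x : PrimeSpectrum.zeroLocus (vanishingIdealOf X : Set (MvPolynomial (Fin n) ℝ)) :=
    ⟨⟨GI Φ y ψ K, GI_prime h _⟩, hle⟩
  let x' : PrimeSpectrum.zeroLocus (vanishingIdealOf X : Set (MvPolynomial (Fin n) ℝ)) :=
    ⟨⟨q, hq.1⟩, hq.2⟩
  have hlt : x' < x := by
    rw [← Subtype.coe_lt_coe, ← PrimeSpectrum.asIdeal_lt_asIdeal]
    exact lt_of_le_not_ge hqle hne
  have h1 := GI_coheight h (vanishingIdealOf X) d K (by omega) x rfl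
  have h2 := Order.coheight_add_one_le hlt
  have h3 := Order.coheight_le_krullDim x'
  rw [algDim, ringKrullDim_quotient] at hd
  rw [hd] at h3
  have h4 : Order.coheight x' ≤ (d : ℕ∞) := by exact_mod_cast h3
  have h5 : (d : ℕ∞) + 1 ≤ d := (add_le_add_left h1 1).trans (h2.trans h4)
  have : d + 1 ≤ d := by exact_mod_cast h5
  omega

def locI (X : Set (Fin n → ℝ)) (y : Fin n → ℝ) : Ideal (MvPolynomial (Fin n) ℝ) where
  carrier := {g | ∀ᶠ x in 𝓝[X] y, eval x g = 0}
  add_mem' := by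
    intro a b ha hb
    simp only [mem_setOf_eq] at *
    filter_upwards [ha, hb] with v h1 h2
    simp [h1, h2]
  zero_mem' := by simp
  smul_mem' := by
    intro c a ha
    simp only [mem_setOf_eq] at *
    filter_upwards [ha] with v h1
    simp [h1]

lemma mem_locI {X : Set (Fin n → ℝ)} {y : Fin n → ℝ} {g : MvPolynomial (Fin n) ℝ} :
    g ∈ locI X y ↔ ∀ᶠ x in 𝓝[X] y, eval x g = 0 := Iff.rfl

lemma locI_le {X : Set (Fin n → ℝ)} (y : Fin n → ℝ) : vanishingIdealOf X ≤ locI X y := by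
  intro g hg
  refine mem_locI.2 ?_
  filter_upwards [self_mem_nhdsWithin] with x hx using hg x hx

lemma locI_eval {X : Set (Fin n → ℝ)} {y : Fin n → ℝ} (hy : y ∈ X) {g : MvPolynomial (Fin n) ℝ}
    (hg : g ∈ locI X y) : eval y g = 0 :=
  (mem_locI.1 hg).self_of_nhdsWithin hy

lemma locI_eq_GI (h : Par Φ y ψ) {X U : Set (Fin n → ℝ)} {K : Finset (Fin n)} (hU : IsOpen U)
    (hyU : y ∈ U) (hyX : y ∈ X) (hXU : X ∩ U = {x ∈ U | ∀ a ∈ K, eval x (Φ a) = 0}) :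
    locI X y = GI Φ y ψ K := by
  have hmem : ∀ x ∈ U, x ∈ X ↔ ∀ a ∈ K, eval x (Φ a) = 0 := by
    intro x hx
    constructor
    · intro hxX
      have : x ∈ X ∩ U := ⟨hxX, hx⟩
      rw [hXU] at this; exact this.2
    · intro hx2
      have : x ∈ X ∩ U := by rw [hXU]; exact ⟨hx, hx2⟩
      exact this.1
  have hc0 : ∀ a ∈ K, evPhi Φ y a = 0 := (hmem y hyU).1 hyX
  ext g
  rw [mem_locI, mem_GI]
  constructor
  · intro hg
    rw [eventually_nhdsWithin_iff] at hg
    have ht : Tendsto (fun v => ψ (evPhi Φ y + piK K v)) (𝓝 0) (𝓝 y) := by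
      have := h.an.continuousAt.tendsto
      rw [h.base] at this
      exact this.comp (add_piK_tendsto _ K)
    filter_upwards [ht.eventually hg, ht.eventually (hU.mem_nhds hyU),
      (add_piK_tendsto _ K).eventually h.ri] with v h1 h2 h3
    refine h1 ((hmem _ h2).2 fun a ha => ?_)
    have := congrFun h3 a
    rw [Pi.add_apply, hc0 a ha, piK_mem K v a ha, add_zero] at this
    exact this
  · intro hg
    rw [eventually_nhdsWithin_iff]
    have ht : Tendsto (fun x => evPhi Φ x - evPhi Φ y) (𝓝 y) (𝓝 0) := by
      have := ((evPhi_cont Φ).tendsto y).sub_const (evPhi Φ y)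
      simpa using this
    filter_upwards [ht.eventually hg, hU.mem_nhds hyU, h.li] with x h1 h2 h3 hxX
    rw [piK_self, add_sub_cancel, h3] at h1
    · exact h1
    · intro a ha
      rw [Pi.sub_apply, hc0 a ha, sub_zero]
      exact (hmem x h2).1 hxX a ha

end Germ

section RegData
open Filter Topology

variable {n : ℕ}

lemma exists_regData {X : Set (Fin n → ℝ)} {z : Fin n → ℝ} (hz : IsRegularPoint X z) :
    ∃ (Φ : Fin n → MvPolynomial (Fin n) ℝ) (K : Finset (Fin n)) (U : Set (Fin n → ℝ)) (d : ℕ),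
      algDim X = d ∧ K.card = n - d ∧ IsOpen U ∧ z ∈ U ∧
      X ∩ U = {x ∈ U | ∀ a ∈ K, eval x (Φ a) = 0} ∧ eval z (muP Φ) ≠ 0 := by
  classical
  obtain ⟨hzX, d, hd, p, U, hU, hzU, hXU, hli⟩ := hz
  let b := Module.Basis.sumExtend hli
  have hb : ∀ j, b (Sum.inl j) = fun i => eval z (pderiv i (p j)) := by
    intro j
    simp [b, Module.Basis.sumExtend]
    rfl
  haveI : Finite (Fin (n - d) ⊕ Module.Basis.sumExtendIndex hli) := Module.Finite.finite_basis b
  haveI := Fintype.ofFinite (Fin (n - d) ⊕ Module.Basis.sumExtendIndex hli)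
  have hcard : Fintype.card (Fin (n - d) ⊕ Module.Basis.sumExtendIndex hli) = n := by
    rw [← Module.finrank_eq_card_basis b]; simp
  let σ : (Fin (n - d) ⊕ Module.Basis.sumExtendIndex hli) ≃ Fin n := Fintype.equivFinOfCardEq hcard
  let P : (Fin (n - d) ⊕ Module.Basis.sumExtendIndex hli) → MvPolynomial (Fin n) ℝ :=
    Sum.elim p (fun i => ∑ m, C (b (Sum.inr i) m) * MvPolynomial.X m)
  have hP : ∀ s m, eval z (pderiv m (P s)) = b s m := by
    rintro (j | i) m
    · rw [hb]; rfl
    · simp only [P, Sum.elim_inr, map_sum, pderiv_C_mul, pderiv_X]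
      rw [Finset.sum_eq_single m]
      · simp
      · intro k _ hk
        simp [Pi.single_apply, hk.symm]
      · simp
  refine ⟨fun a => P (σ.symm a), Finset.univ.image (fun j => σ (Sum.inl j)), U, d, hd, ?_, hU, hzU,
    ?_, ?_⟩
  · rw [Finset.card_image_of_injective]
    · simp
    · intro i j hij
      simpa using hij
  · rw [hXU]
    ext x
    simp [P]
  · have : eval z (muP (fun a => P (σ.symm a))) =
        Matrix.det (Matrix.of fun a m => b (σ.symm a) m) := by
      rw [muP, RingHom.map_det]
      congr 1
      ext a m
      simp [jacM, hP]
    rw [this]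
    have hli2 : LinearIndependent ℝ (fun a => b (σ.symm a)) :=
      b.linearIndependent.comp _ σ.symm.injective
    have := (Matrix.linearIndependent_rows_iff_isUnit (A := Matrix.of fun a m => b (σ.symm a) m)).1
      hli2
    exact ((Matrix.isUnit_iff_isUnit_det _).1 this).ne_zero

end RegData

section LocRat
open Filter Topology

variable {n : ℕ}

lemma mem_vI {S : Set (Fin n → ℝ)} {g : MvPolynomial (Fin n) ℝ} :
    g ∈ vanishingIdealOf S ↔ ∀ x ∈ S, eval x g = 0 := Iff.rfl

lemma vI_anti {S T : Set (Fin n → ℝ)} (h : S ⊆ T) : vanishingIdealOf T ≤ vanishingIdealOf S :=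
  fun _ hg x hx => hg x (h hx)

lemma eval_sumsq_eq_zero {k : ℕ} (p : Fin k → MvPolynomial (Fin n) ℝ) (x : Fin n → ℝ) :
    eval x (∑ i, p i ^ 2) = 0 ↔ ∀ i, eval x (p i) = 0 := by
  simp only [map_sum, map_pow]
  rw [Finset.sum_eq_zero_iff_of_nonneg (fun _ _ => sq_nonneg _)]
  simp

lemma alg_inter {X : Set (Fin n → ℝ)} (hX : IsRealAlgebraicSet X) (g : MvPolynomial (Fin n) ℝ) :
    IsRealAlgebraicSet (X ∩ {x | eval x g = 0}) := by
  obtain ⟨k, p, rfl⟩ := hX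
  refine ⟨k + 1, Fin.cons g p, ?_⟩
  ext x
  simp [Fin.forall_fin_succ, and_comm]

lemma global_pq {X : Set (Fin n → ℝ)} (hX : IsRealAlgebraicSet X) {f : (Fin n → ℝ) → ℝ}
    (hf : IsRatCont X f) : ∃ Pn Q : MvPolynomial (Fin n) ℝ,
      (∀ x ∈ X, f x * eval x Q = eval x Pn) ∧
      ∀ g, (∀ x ∈ X, eval x Q ≠ 0 → eval x g = 0) → g ∈ vanishingIdealOf X := by
  obtain ⟨-, U, ⟨hUX, k, hk, hXU⟩, hdense, p, q, hq, hfpq⟩ := hf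
  have hv : ∀ x ∈ X, eval x (∑ i, hk i ^ 2) = 0 ↔ x ∉ U := by
    intro x hx
    rw [eval_sumsq_eq_zero]
    have : x ∈ X \ U ↔ ∀ i, eval x (hk i) = 0 := by rw [hXU]; rfl
    rw [← this]
    simp [hx]
  refine ⟨p * ∑ i, hk i ^ 2, q * ∑ i, hk i ^ 2, fun x hx => ?_, fun g hg => ?_⟩
  · rw [map_mul, map_mul]
    by_cases hxU : x ∈ U
    · rw [hfpq x hxU]
      have := hq x hxU
      field_simp
    · rw [(hv x hx).2 hxU]; simp
  · have := hdense (X ∩ {x | eval x g = 0}) ⟨alg_inter hX g, inter_subset_left⟩ (by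
      intro x hxU
      refine ⟨hUX hxU, hg x (hUX hxU) ?_⟩
      rw [map_mul]
      refine mul_ne_zero (hq x hxU) fun h0 => ?_
      exact (hv x (hUX hxU)).1 h0 hxU)
    intro x hx
    rw [← this] at hx
    exact hx.2

lemma regular_pack {X : Set (Fin n → ℝ)} {z : Fin n → ℝ} (hz : IsRegularPoint X z) :
    locI X z ∈ (vanishingIdealOf X).minimalPrimes ∧
    ∃ (Φ : Fin n → MvPolynomial (Fin n) ℝ) (K : Finset (Fin n)) (ψ : (Fin n → ℝ) → (Fin n → ℝ)),
      Par Φ z ψ ∧ locI X z = GI Φ z ψ K := by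
  obtain ⟨Φ, K, U, d, hd, hK, hU, hzU, hXU, hmu⟩ := exists_regData hz
  obtain ⟨ψ, h⟩ := exists_par Φ z hmu
  have he := locI_eq_GI h hU hzU hz.1 hXU
  refine ⟨?_, Φ, K, ψ, h, he⟩
  have := GI_minimal h hd hK (he ▸ locI_le z)
  rwa [he]

lemma vI_radical (X : Set (Fin n → ℝ)) : (vanishingIdealOf X).IsRadical := by
  rintro g ⟨k, hk⟩ x hx
  have := hk x hx
  rw [map_pow] at this
  exact eq_zero_of_pow_eq_zero this

lemma Q_not_mem {X : Set (Fin n → ℝ)} {z : Fin n → ℝ} (hz : IsRegularPoint X z)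
    {Q : MvPolynomial (Fin n) ℝ}
    (hQ : ∀ g, (∀ x ∈ X, eval x Q ≠ 0 → eval x g = 0) → g ∈ vanishingIdealOf X) :
    Q ∉ locI X z := by
  intro hmem
  obtain ⟨g, hg, hgk⟩ := Ideal.exists_mul_mem_of_mem_minimalPrimes (regular_pack hz).1 hmem
  refine hg (hQ g fun x hx hqx => ?_)
  have h1 := hgk x hx
  rw [map_mul] at h1
  exact (mul_eq_zero.1 h1).resolve_left hqx

lemma core {X : Set (Fin n → ℝ)} (hX : IsRealAlgebraicSet X) {f : (Fin n → ℝ) → ℝ}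
    (hf : ContinuousOn f X) {Pn Q : MvPolynomial (Fin n) ℝ}
    (hPQ : ∀ x ∈ X, f x * eval x Q = eval x Pn)
    {T : Set (Fin n → ℝ)} (hTX : T ⊆ X) (hT : (vanishingIdealOf T).IsPrime)
    {z : Fin n → ℝ} (hzT : z ∈ T) (hQz : Q ∉ locI X z) (hle : locI X z ≤ vanishingIdealOf T)
    (hreg : IsRegularPoint X z) :
    ∃ p q : MvPolynomial (Fin n) ℝ, (∀ x ∈ T, f x * eval x q = eval x p) ∧
      q ∉ vanishingIdealOf T := by
  classical
  obtain ⟨-, Φ, K, ψ, h, he⟩ := regular_pack hreg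
  obtain ⟨v, hv, hj⟩ : ∃ v : Fin n → ℝ, (∀ a ∈ K, v a = 0) ∧
      ∃ j, (DD Φ v)^[j] Q ∉ vanishingIdealOf T := by
    by_contra! hcon
    refine hQz ?_
    rw [he]
    exact GI_of_DD h fun v hv j => hcon v hv j z hzT
  set m := Nat.find hj with hm
  have hmQ : (DD Φ v)^[m] Q ∉ vanishingIdealOf T := Nat.find_spec hj
  have hlow : ∀ i < m, (DD Φ v)^[i] Q ∈ vanishingIdealOf T := fun i hi => by
    have := Nat.find_min hj hi
    simpa using this
  have key : ∀ y ∈ T, eval y (muP Φ) ≠ 0 → ∀ i ≤ m,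
      f y * eval y ((DD Φ v)^[i] Q) = eval y ((DD Φ v)^[i] Pn) := by
    intro y hyT hmu
    obtain ⟨ψ', h'⟩ := exists_par Φ y hmu
    have hγX : ∀ᶠ t : ℝ in 𝓝 0, ψ' (evPhi Φ y + t • v) ∈ X := by
      obtain ⟨k, g, hg⟩ := hX
      have : ∀ i, ∀ᶠ t : ℝ in 𝓝 0, eval (ψ' (evPhi Φ y + t • v)) (g i) = 0 := by
        intro i
        refine h'.zero_line v (g i) fun j => ?_
        refine hle ?_ y hyT
        rw [he]
        refine GI_stable_iter h ?_ hv j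
        rw [← he]
        refine locI_le z ?_
        intro x hx
        rw [hg] at hx
        exact hx i
      filter_upwards [eventually_all.2 this] with t ht
      rw [hg]; exact ht
    have hγ : Tendsto (fun t : ℝ => ψ' (evPhi Φ y + t • v)) (𝓝 0) (𝓝 y) := by
      have := h'.an.continuousAt.tendsto
      rw [h'.base] at this
      exact this.comp (line_tendsto _ v)
    have hfγ : Tendsto (fun t : ℝ => f (ψ' (evPhi Φ y + t • v))) (𝓝 0) (𝓝 (f y)) :=
      (hf y (hTX hyT)).tendsto.comp (tendsto_nhdsWithin_iff.2 ⟨hγ, hγX⟩)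
    intro i
    induction i using Nat.strong_induction_on with
    | _ i ih =>
      intro him
      have hQ0 : ∀ l < i, eval y ((DD Φ v)^[l] Q) = 0 := fun l hl => hlow l (by omega) y hyT
      have hP0 : ∀ l < i, eval y ((DD Φ v)^[l] Pn) = 0 := fun l hl => by
        rw [← ih l hl (by omega), hQ0 l hl, mul_zero]
      have h1 := h'.lhop v i Q hQ0
      have h2 := h'.lhop v i Pn hP0
      have h3 := (hfγ.mono_left (nhdsWithin_le_nhds (s := {0}ᶜ))).mul h1
      have h4 := tendsto_nhds_unique (h3.congr' (by
        filter_upwards [hγX.filter_mono nhdsWithin_le_nhds] with t ht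
        rw [← mul_div_assoc, hPQ _ ht])) h2
      have h5 : ((i.factorial : ℝ) * eval y (muP Φ) ^ i) ≠ 0 :=
        mul_ne_zero (by exact_mod_cast i.factorial_ne_zero) (pow_ne_zero _ hmu)
      rw [← mul_div_assoc, div_left_inj' h5] at h4
      exact h4
  refine ⟨muP Φ * (DD Φ v)^[m] Pn, muP Φ * (DD Φ v)^[m] Q, fun x hx => ?_, fun hmem => ?_⟩
  · rw [map_mul, map_mul]
    by_cases hmu : eval x (muP Φ) = 0
    · simp [hmu]
    · rw [← key x hx hmu m le_rfl]; ring
  · rcases hT.mem_or_mem hmem with h1 | h1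
    · exact h.mu (h1 z hzT)
    · exact hmQ h1

lemma exists_prime_piece {Z : Set (Fin n → ℝ)} (hZ : Z.Nonempty) :
    ∃ e : MvPolynomial (Fin n) ℝ, (vanishingIdealOf (Z ∩ {x | eval x e ≠ 0})).IsPrime := by
  let A : Set (Ideal (MvPolynomial (Fin n) ℝ)) :=
    {J | ∃ e, e ∉ vanishingIdealOf Z ∧ J = vanishingIdealOf (Z ∩ {x | eval x e ≠ 0})}
  have hA : A.Nonempty := by
    refine ⟨_, 1, ?_, rfl⟩
    obtain ⟨x, hx⟩ := hZ
    intro h1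
    simpa using h1 x hx
  obtain ⟨J, ⟨e, he, rfl⟩, hmax⟩ := set_has_maximal_iff_noetherian.2
    (inferInstanceAs (IsNoetherianRing (MvPolynomial (Fin n) ℝ))) A hA
  refine ⟨e, Ideal.isPrime_iff.2 ⟨fun htop => ?_, fun {g k} hgk => ?_⟩⟩
  · have h1 : (1 : MvPolynomial (Fin n) ℝ) ∈ vanishingIdealOf (Z ∩ {x | eval x e ≠ 0}) := by
      rw [htop]; trivial
    refine he fun x hx => ?_
    by_contra h2
    simpa using h1 x ⟨hx, h2⟩
  · by_contra! hcon
    obtain ⟨hg, hk⟩ := hcon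
    have heg : e * g ∉ vanishingIdealOf Z := by
      intro h1
      refine hg fun x hx => ?_
      have := h1 x hx.1
      rw [map_mul] at this
      exact (mul_eq_zero.1 this).resolve_left hx.2
    have hsub : Z ∩ {x | eval x (e * g) ≠ 0} ⊆ Z ∩ {x | eval x e ≠ 0} := by
      rintro x ⟨hx, hx2⟩
      refine ⟨hx, fun h0 => hx2 ?_⟩
      rw [map_mul, h0, zero_mul]
    have hnlt := hmax _ ⟨e * g, heg, rfl⟩
    refine hnlt (lt_of_le_of_ne (vI_anti hsub) fun heq => hk ?_)
    rw [heq]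
    rintro x ⟨hx, hx2⟩
    have h1 := hgk x (hsub ⟨hx, hx2⟩)
    rw [map_mul] at h1
    refine (mul_eq_zero.1 h1).resolve_left fun h0 => hx2 ?_
    rw [map_mul, h0, mul_zero]

lemma exists_label {L : Type*} {T : Set (Fin n → ℝ)} (hT : (vanishingIdealOf T).IsPrime)
    (lab : (Fin n → ℝ) → L) (hfin : (lab '' T).Finite) :
    ∃ l, vanishingIdealOf {y ∈ T | lab y = l} ≤ vanishingIdealOf T := by
  classical
  have h1 : hfin.toFinset.inf (fun l => vanishingIdealOf {y ∈ T | lab y = l}) ≤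
      vanishingIdealOf T := by
    intro g hg x hx
    rw [Submodule.mem_finsetInf] at hg
    exact hg (lab x) (by simpa using ⟨x, hx, rfl⟩) x ⟨hx, rfl⟩
  obtain ⟨l, -, hl⟩ := (hT.inf_le').1 h1
  exact ⟨l, hl⟩

theorem loc_rational {X : Set (Fin n → ℝ)} (hX : IsRealAlgebraicSet X)
    (hsing : (X \ {x | IsRegularPoint X x}).Finite) {f : (Fin n → ℝ) → ℝ} (hf : IsRatCont X f)
    {Z : Set (Fin n → ℝ)} (hZX : Z ⊆ X) (hZ : Z.Nonempty) :
    ∃ p q : MvPolynomial (Fin n) ℝ, (∀ x ∈ Z, f x * eval x q = eval x p) ∧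
      ∃ x ∈ Z, eval x q ≠ 0 := by
  classical
  obtain ⟨Pn, Q, hPQ, hQ⟩ := global_pq hX hf
  obtain ⟨e, hT⟩ := exists_prime_piece hZ
  set T := Z ∩ {x | eval x e ≠ 0} with hTdef
  have hTX : T ⊆ X := inter_subset_left.trans hZX
  suffices ∃ p q : MvPolynomial (Fin n) ℝ, (∀ x ∈ T, f x * eval x q = eval x p) ∧
      q ∉ vanishingIdealOf T by
    obtain ⟨p, q, h1, h2⟩ := this
    refine ⟨p * e, q * e, fun x hx => ?_, ?_⟩
    · rw [map_mul, map_mul]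
      by_cases hex : eval x e = 0
      · simp [hex]
      · rw [← h1 x ⟨hx, hex⟩]; ring
    · by_contra! hcon
      refine h2 fun x hx => ?_
      have := hcon x hx.1
      rw [map_mul] at this
      exact (mul_eq_zero.1 this).resolve_right hx.2
  let lab : (Fin n → ℝ) → (Fin n → ℝ) ⊕ Ideal (MvPolynomial (Fin n) ℝ) :=
    fun y => if IsRegularPoint X y then Sum.inr (locI X y) else Sum.inl y
  have hfin : (lab '' T).Finite := by
    refine Set.Finite.subset ((hsing.image Sum.inl).union
      (((vanishingIdealOf X).finite_minimalPrimes_of_isNoetherianRing _).image Sum.inr)) ?_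
    rintro _ ⟨y, hy, rfl⟩
    by_cases hr : IsRegularPoint X y
    · right
      exact ⟨locI X y, (regular_pack hr).1, by simp [lab, hr]⟩
    · left
      exact ⟨y, ⟨hTX hy, hr⟩, by simp [lab, hr]⟩
  obtain ⟨l, hl⟩ := exists_label hT lab hfin
  have hne : {y ∈ T | lab y = l}.Nonempty := by
    by_contra hemp
    rw [not_nonempty_iff_eq_empty] at hemp
    apply hT.ne_top
    rw [Ideal.eq_top_iff_one]
    refine hl ?_
    rw [hemp]
    intro x hx
    exact absurd hx (by simp)
  obtain ⟨z, hzT, hzl⟩ := hne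
  by_cases hr : IsRegularPoint X z
  · refine core hX hf.1 hPQ hTX hT hzT (Q_not_mem hr hQ) ?_ hr
    refine le_trans ?_ hl
    rintro g hg y ⟨hyT, hyl⟩
    rw [← hzl] at hyl
    by_cases hry : IsRegularPoint X y
    · simp only [lab, hr, hry, if_true, Sum.inr.injEq] at hyl
      rw [← hyl] at hg
      exact locI_eval (hTX hyT) hg
    · simp [lab, hr, hry] at hyl
  · refine ⟨C (f z), 1, fun x hx => ?_, fun h1 => ?_⟩
    · have : x = z := by
        ext i
        have h1 : (MvPolynomial.X i - C (z i) : MvPolynomial (Fin n) ℝ) ∈ vanishingIdealOf T := by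
          refine hl ?_
          rintro y ⟨hyT, hyl⟩
          rw [← hzl] at hyl
          by_cases hry : IsRegularPoint X y
          · simp [lab, hr, hry] at hyl
          · simp only [lab, hr, hry, if_false, Sum.inl.injEq] at hyl
            simp [hyl]
        have := h1 x hx
        simpa [sub_eq_zero] using this
      simp [this]
    · simpa using h1 z hzT

end LocRat

section Assembly
open Filter Topology

theorem assemble {n : ℕ} {X : Set (Fin n → ℝ)} (hX : IsRealAlgebraicSet X)
    (hsing : (X \ {x | IsRegularPoint X x}).Finite) {f : (Fin n → ℝ) → ℝ} (hf : IsRatCont X f)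
    (J : Ideal (MvPolynomial (Fin n) ℝ)) : ∀ P : MvPolynomial (Fin n) ℝ, (∀ x, 0 ≤ eval x P) →
    {x | eval x P = 0} ⊆ X → vanishingIdealOf {x | eval x P = 0} = J →
    ∃ g : (Fin n → ℝ) → ℝ, Continuous g ∧ (∀ x, eval x P = 0 → g x = f x) ∧
      ∃ a b : MvPolynomial (Fin n) ℝ, ∀ x, eval x P ≠ 0 → eval x b ≠ 0 ∧
        g x = eval x a / eval x b := by
  induction J using WellFoundedGT.induction with
  | ind J ih =>
    intro P hP hPX hJ
    by_cases hZ : {x | eval x P = 0}.Nonempty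
    swap
    · refine ⟨fun _ => 0, continuous_const, fun x hx => absurd ⟨x, hx⟩ hZ, 0, 1, fun x _ => ?_⟩
      simp
    obtain ⟨p, q, hpq, x₀, hx₀, hqx₀⟩ := loc_rational hX hsing hf hPX hZ
    have hP' : ∀ x, eval x (P + q ^ 2) = 0 ↔ eval x P = 0 ∧ eval x q = 0 := by
      intro x
      rw [map_add, map_pow, add_eq_zero_iff_of_nonneg (hP x) (sq_nonneg _)]
      simp
    have hsub : {x | eval x (P + q ^ 2) = 0} ⊆ {x | eval x P = 0} := fun x hx => ((hP' x).1 hx).1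
    have hlt : J < vanishingIdealOf {x | eval x (P + q ^ 2) = 0} := by
      rw [← hJ]
      refine lt_of_le_of_ne (vI_anti hsub) fun heq => ?_
      have : q ∈ vanishingIdealOf {x | eval x P = 0} := by
        rw [heq]; intro x hx; exact ((hP' x).1 hx).2
      exact hqx₀ (this x₀ hx₀)
    obtain ⟨g', hg'c, hg'f, a, b, hab⟩ := ih _ hlt (P + q ^ 2)
      (fun x => by rw [map_add, map_pow]; have := hP x; positivity) (hsub.trans hPX) rfl
    have hz : ∀ x, eval x P = 0 → eval x q = 0 → f x - g' x = 0 := fun x h1 h2 => by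
      rw [hg'f x ((hP' x).2 ⟨h1, h2⟩), sub_self]
    have hnz : ∀ x, eval x q ≠ 0 → eval x b ≠ 0 ∧ g' x = eval x a / eval x b := fun x h1 =>
      hab x fun h2 => h1 ((hP' x).1 h2).2
    obtain ⟨F, hFc, hFh, α, β, hαβ⟩ := extend_step P (p * b - a * q) (q * b) hP
      (fun x => f x - g' x) ((hf.1.mono hPX).sub hg'c.continuousOn) (by
        intro x hx
        simp only [map_sub, map_mul]
        have h1 := hpq x hx
        by_cases hq : eval x q = 0
        · rw [hz x hx hq, ← h1, hq]; ring
        · obtain ⟨hb, hg⟩ := hnz x hq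
          rw [hg, ← h1]; field_simp) (by
        intro x hx hqb
        refine hz x hx ?_
        by_contra hq
        rw [map_mul] at hqb
        exact mul_ne_zero hq (hnz x hq).1 hqb)
    refine ⟨fun x => F x + g' x, hFc.add hg'c, fun x hx => ?_, α * b + a * β, β * b, fun x hx => ?_⟩
    · simp only [hFh x hx]; ring
    · obtain ⟨h1, h2⟩ := hαβ x hx
      obtain ⟨h3, h4⟩ := hab x fun h => hx ((hP' x).1 h).1
      refine ⟨by rw [map_mul]; exact mul_ne_zero h1 h3, ?_⟩
      simp only [h2, h4, map_add, map_mul]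
      field_simp

end Assembly

/-- on a real algebraic set with only isolated singularities (finite singular
locus), every rational continuous function is regulous. -/
theorem ratCont_isRegulous_of_isolated_singularities {n : ℕ} (X : Set (Fin n → ℝ))
    (hX : IsRealAlgebraicSet X)
    (hsing : (X \ {x | IsRegularPoint X x}).Finite)
    (f : (Fin n → ℝ) → ℝ) (hf : IsRatCont X f) :
    IsRegulousOn X f := by
  by_cases hXu : X = Set.univ
  · subst hXu
    obtain ⟨hc, U, hU, hd, hr⟩ := hf
    refine ⟨f, ⟨continuousOn_univ.1 hc, U, hU, ?_, hr⟩, fun _ _ => rfl⟩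
    by_contra hne
    rw [Set.not_nonempty_iff_eq_empty] at hne
    have h1 : IsZariskiClosedIn (Set.univ : Set (Fin n → ℝ)) ∅ := by
      refine ⟨⟨1, fun _ => 1, ?_⟩, Set.subset_univ _⟩
      ext x; simp
    have h2 := hd ∅ h1 (by rw [hne])
    have h3 : (0 : Fin n → ℝ) ∈ (∅ : Set (Fin n → ℝ)) := by rw [h2]; trivial
    exact h3
  · have hX' := hX
    obtain ⟨k, p, hp⟩ := hX'
    have hz : ∀ x, eval x (∑ i, p i ^ 2) = 0 ↔ x ∈ X := by
      intro x
      rw [eval_sumsq_eq_zero, hp]; rfl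
    obtain ⟨g, hgc, hgf, a, b, hab⟩ := assemble hX hsing hf _ (∑ i, p i ^ 2)
      (fun x => by
        simp only [map_sum, map_pow]
        exact Finset.sum_nonneg fun _ _ => sq_nonneg _)
      (fun x hx => (hz x).1 hx) rfl
    refine ⟨g, ⟨hgc, Xᶜ, ⟨Set.subset_univ _, ?_⟩, Set.nonempty_compl.2 hXu, a, b, ?_, ?_⟩, ?_⟩
    · simpa [Set.diff_compl] using hX
    · intro x hx
      exact (hab x fun h => hx ((hz x).1 h)).1
    · intro x hx
      exact (hab x fun h => hx ((hz x).1 h)).2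
    · intro x hx
      exact (hgf x ((hz x).2 hx)).symm
end

section
/- Let X ⊆ ℝⁿ be a real algebraic set. Every regulous function f on X is arc-analytic: for every open interval I ⊆ ℝ and every real analytic map γ : I → ℝⁿ with γ(I) ⊆ X, the composite f ∘ γ : I → ℝ is real analytic on I. -/
open MvPolynomial Set

lemma aux_poly (k : ℕ) : ∀ (D C : Polynomial ℝ) (h : ℝ → ℝ), Continuous h →
    (∀ s, D.eval s = C.eval s * h s) → (∀ j < k, C.coeff j = 0) →
    D.coeff k = C.coeff k * h 0 := by
  induction k with
  | zero =>
    intro D C h hh he _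
    have := he 0
    rwa [← Polynomial.coeff_zero_eq_eval_zero, ← Polynomial.coeff_zero_eq_eval_zero] at this
  | succ k ih =>
    intro D C h hh he hC
    have hC0 : C.coeff 0 = 0 := hC 0 (Nat.succ_pos k)
    have hD0 : D.coeff 0 = 0 := by
      have := he 0
      rw [← Polynomial.coeff_zero_eq_eval_zero, ← Polynomial.coeff_zero_eq_eval_zero, hC0] at this
      simpa using this
    obtain ⟨D', rfl⟩ := Polynomial.X_dvd_iff.2 hD0
    obtain ⟨C', rfl⟩ := Polynomial.X_dvd_iff.2 hC0
    rw [Polynomial.coeff_X_mul, Polynomial.coeff_X_mul]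
    refine ih D' C' h hh ?_ ?_
    · have h1 : Continuous fun s => D'.eval s := D'.continuous
      have h2 : Continuous fun s => C'.eval s * h s := C'.continuous.mul hh
      have hd : Dense ({0}ᶜ : Set ℝ) := dense_compl_singleton 0
      have := Continuous.ext_on hd h1 h2 (by
        intro s hs
        have h3 := he s
        simp only [Polynomial.eval_mul, Polynomial.eval_X, mul_assoc] at h3
        exact mul_left_cancel₀ hs h3)
      exact fun s => congrFun this s
    · intro j hj
      have := hC (j + 1) (by omega)
      rwa [Polynomial.coeff_X_mul] at this

/-- restriction of a polynomial to the line `x + s v`. -/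
noncomputable def lineP {n : ℕ} (v x : Fin n → ℝ) (q : MvPolynomial (Fin n) ℝ) : Polynomial ℝ :=
  MvPolynomial.aeval (fun i => Polynomial.C (x i) + Polynomial.X * Polynomial.C (v i)) q

lemma lineP_eval {n : ℕ} (v x : Fin n → ℝ) (q : MvPolynomial (Fin n) ℝ) (s : ℝ) :
    (lineP v x q).eval s = MvPolynomial.eval (fun i => x i + s * v i) q := by
  unfold lineP
  induction q using MvPolynomial.induction_on with
  | C a => simp
  | add p q hp hq => rw [map_add, Polynomial.eval_add, hp, hq, map_add]
  | mul_X p i hp =>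
    rw [map_mul, Polynomial.eval_mul, hp, map_mul, MvPolynomial.aeval_X, MvPolynomial.eval_X]
    rw [Polynomial.eval_add, Polynomial.eval_mul, Polynomial.eval_C, Polynomial.eval_C, Polynomial.eval_X]

lemma lineP_analytic {n : ℕ} (v : Fin n → ℝ) (γ : ℝ → Fin n → ℝ) (t₀ : ℝ)
    (hγ : AnalyticAt ℝ γ t₀) (q : MvPolynomial (Fin n) ℝ) :
    ∀ k, AnalyticAt ℝ (fun t => (lineP v (γ t) q).coeff k) t₀ := by
  have hγi : ∀ i, AnalyticAt ℝ (fun t => γ t i) t₀ := fun i => (analyticAt_pi_iff.1 hγ) i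
  unfold lineP
  induction q using MvPolynomial.induction_on with
  | C a =>
    intro k
    simp only [MvPolynomial.algHom_C]
    exact analyticAt_const
  | add p q hp hq =>
    intro k
    simp only [map_add, Polynomial.coeff_add]
    exact (hp k).add (hq k)
  | mul_X p i hp =>
    intro k
    simp only [map_mul, MvPolynomial.aeval_X, mul_add, Polynomial.coeff_add,
      Polynomial.coeff_mul_C, ← mul_assoc]
    refine ((hp k).mul (hγi i)).add ?_
    cases k with
    | zero => simp only [Polynomial.coeff_mul_X_zero, zero_mul]; exact analyticAt_const
    | succ k => simp only [Polynomial.coeff_mul_X]; exact (hp k).mul analyticAt_const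

/-- every regulous function on a real algebraic set `X` is arc-analytic: for any
real analytic arc `γ` on an open interval with values in `X`, `f ∘ γ` is real analytic. -/
theorem regulous_arcAnalytic {n : ℕ} (X : Set (Fin n → ℝ)) (hX : IsRealAlgebraicSet X)
    (f : (Fin n → ℝ) → ℝ) (hf : IsRegulousOn X f)
    (a b : ℝ) (γ : ℝ → Fin n → ℝ)
    (hγ : AnalyticOnNhd ℝ γ (Set.Ioo a b))
    (hγX : ∀ t ∈ Set.Ioo a b, γ t ∈ X) :
    AnalyticOnNhd ℝ (f ∘ γ) (Set.Ioo a b) := by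
  intro t₀ ht₀
  obtain ⟨g, ⟨hg, U, ⟨-, m, r, hr⟩, ⟨x₀, hx₀⟩, p, q, hq, hpq⟩, hfg⟩ := hf
  have hγ0 := hγ t₀ ht₀
  -- a global polynomial identity
  obtain ⟨P, Q, hQ0, hPQ⟩ : ∃ P Q : MvPolynomial (Fin n) ℝ, MvPolynomial.eval x₀ Q ≠ 0 ∧
      ∀ x, MvPolynomial.eval x P = MvPolynomial.eval x Q * g x := by
    have h1 : x₀ ∉ Set.univ \ U := fun h => h.2 hx₀
    rw [hr] at h1
    simp only [Set.mem_setOf_eq, not_forall] at h1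
    obtain ⟨i, hi⟩ := h1
    refine ⟨p * r i, q * r i, ?_, ?_⟩
    · rw [map_mul]; exact mul_ne_zero (hq x₀ hx₀) hi
    · intro x
      rw [map_mul, map_mul]
      by_cases hx : x ∈ U
      · rw [hpq x hx]
        field_simp [hq x hx]
      · have h2 : x ∈ Set.univ \ U := ⟨trivial, hx⟩
        rw [hr] at h2
        rw [h2 i]; ring
  set v : Fin n → ℝ := x₀ - γ t₀ with hv
  have hex : ∃ k, ¬ ∀ᶠ t in nhds t₀, (lineP v (γ t) Q).coeff k = 0 := by
    by_contra hcon
    push Not at hcon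
    have hz : lineP v (γ t₀) Q = 0 := by
      ext k
      simpa using (hcon k).self_of_nhds
    have h2 := lineP_eval v (γ t₀) Q 1
    rw [hz] at h2
    have h3 : (fun i => γ t₀ i + 1 * v i) = x₀ := by ext i; simp [hv]
    rw [h3] at h2
    exact hQ0 (by simpa using h2.symm)
  classical
  have hk := Nat.find_spec hex
  have hkmin : ∀ j < Nat.find hex, ∀ᶠ t in nhds t₀, (lineP v (γ t) Q).coeff j = 0 :=
    fun j hj => not_not.1 (Nat.find_min hex hj)
  generalize Nat.find hex = k at hk hkmin
  have hc := lineP_analytic v γ t₀ hγ0 Q k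
  have hd := lineP_analytic v γ t₀ hγ0 P k
  have hall : ∀ᶠ t in nhds t₀, ∀ j < k, (lineP v (γ t) Q).coeff j = 0 :=
    (Filter.eventually_all_finite (Set.finite_lt_nat k)).2 hkmin
  have hrel : ∀ᶠ t in nhds t₀,
      (lineP v (γ t) P).coeff k = (lineP v (γ t) Q).coeff k * g (γ t) := by
    filter_upwards [hall] with t ht
    have := aux_poly k (lineP v (γ t) P) (lineP v (γ t) Q)
      (fun s => g (fun i => γ t i + s * v i)) (hg.comp (by fun_prop))
      (fun s => by rw [lineP_eval, lineP_eval]; exact hPQ _) ht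
    simpa using this
  have hne : ∀ᶠ t in nhdsWithin t₀ {t₀}ᶜ, (lineP v (γ t) Q).coeff k ≠ 0 :=
    hc.eventually_eq_zero_or_eventually_ne_zero.resolve_left hk
  have hmer : MeromorphicAt (g ∘ γ) t₀ := by
    refine (hd.meromorphicAt.div hc.meromorphicAt).congr ?_
    filter_upwards [hne, hrel.filter_mono nhdsWithin_le_nhds] with t h1 h2
    simp only [Pi.div_apply, Function.comp]
    rw [h2]; field_simp
  have han : AnalyticAt ℝ (g ∘ γ) t₀ :=
    hmer.analyticAt (hg.continuousAt.comp hγ0.continuousAt)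
  refine han.congr ?_
  filter_upwards [isOpen_Ioo.mem_nhds ht₀] with t ht
  exact (hfg _ (hγX t ht)).symm
end

section
/- Let X ⊆ ℝⁿ be a real algebraic set and let f be a regulous function on X. Then the sign of f is a finite sum of signs of polynomial functions on X: there exist finitely many polynomial functions p₁, …, p_k on X such that for every x ∈ X, sign(f)(x) = sign(p₁)(x) + ⋯ + sign(p_k)(x). -/
open MvPolynomial Set

theorem aux_coeff (k : ℕ) : ∀ (A B : Polynomial ℝ) (F : ℝ → ℝ), Continuous F →
    (∀ t, F t * B.eval t = A.eval t) → (∀ j < k, B.coeff j = 0) →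
    F 0 * B.coeff k = A.coeff k := by
  induction k with
  | zero =>
    intro A B F _ h _
    simpa [Polynomial.coeff_zero_eq_eval_zero] using h 0
  | succ k ih =>
    intro A B F hF h hB
    have hB0 : B.coeff 0 = 0 := hB 0 (Nat.succ_pos k)
    have hA0 : A.coeff 0 = 0 := by
      have := h 0
      rw [← Polynomial.coeff_zero_eq_eval_zero, ← Polynomial.coeff_zero_eq_eval_zero, hB0] at this
      simpa using this.symm
    have eB : B = Polynomial.divX B * Polynomial.X := by
      have := Polynomial.divX_mul_X_add B
      rw [hB0] at this; simpa using this.symm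
    have eA : A = Polynomial.divX A * Polynomial.X := by
      have := Polynomial.divX_mul_X_add A
      rw [hA0] at this; simpa using this.symm
    have key : (fun t => F t * B.divX.eval t) = fun t => A.divX.eval t := by
      apply Continuous.ext_on (dense_compl_singleton (0 : ℝ))
      · exact hF.mul B.divX.continuous
      · exact A.divX.continuous
      · intro t ht
        have ht : t ≠ 0 := ht
        have := h t
        rw [eB, eA, Polynomial.eval_mul, Polynomial.eval_mul, Polynomial.eval_X, ← mul_assoc] at this
        exact mul_right_cancel₀ ht this
    have := ih A.divX B.divX F hF (fun t => congrFun key t) (fun j hj => by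
      rw [Polynomial.coeff_divX]; exact hB _ (by omega))
    simpa [Polynomial.coeff_divX] using this

theorem aux_dir {n : ℕ} (Q : MvPolynomial (Fin n) ℝ) (hQ : Q ≠ 0) :
    ∃ v : Fin n → ℝ, ∀ x : Fin n → ℝ, ∃ t : ℝ,
      MvPolynomial.eval (fun i => x i + t * v i) Q ≠ 0 := by
  have hh : MvPolynomial.homogeneousComponent Q.totalDegree Q ≠ 0 := by
    intro h0
    obtain ⟨m, hm, hd⟩ := Finset.exists_mem_eq_sup Q.support
      (MvPolynomial.support_nonempty.2 hQ) (fun s => s.sum fun _ e => e)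
    have hd : Q.totalDegree = m.sum fun _ e => e := hd
    have := congrArg (MvPolynomial.coeff m) h0
    rw [MvPolynomial.coeff_homogeneousComponent, if_pos] at this
    · exact (MvPolynomial.mem_support_iff.1 hm) (by simpa using this)
    · rw [hd]; rfl
  obtain ⟨v, hv⟩ : ∃ v, MvPolynomial.eval v
      (MvPolynomial.homogeneousComponent Q.totalDegree Q) ≠ 0 := by
    by_contra! hc
    exact hh (MvPolynomial.funext fun x => by simpa using hc x)
  refine ⟨v, fun x => ?_⟩
  by_contra! hc
  let R : ℝ → ℝ := fun s => ∑ m ∈ Q.support, Q.coeff m *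
    (s ^ (Q.totalDegree - m.degree) * ∏ i, (s * x i + v i) ^ m i)
  have hR : R = fun _ => 0 := by
    apply Continuous.ext_on (dense_compl_singleton (0 : ℝ))
    · fun_prop
    · fun_prop
    · intro s hs
      have hs : s ≠ 0 := hs
      have h1 := hc s⁻¹
      rw [MvPolynomial.eval_eq'] at h1
      have h2 : R s = s ^ Q.totalDegree *
          ∑ m ∈ Q.support, Q.coeff m * ∏ i, (x i + s⁻¹ * v i) ^ m i := by
        rw [Finset.mul_sum]
        refine Finset.sum_congr rfl fun m hm => ?_
        have hle : m.degree ≤ Q.totalDegree := MvPolynomial.le_totalDegree hm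
        have e1 : ∏ i, (s * x i + v i) ^ m i
            = s ^ m.degree * ∏ i, (x i + s⁻¹ * v i) ^ m i := by
          rw [Finsupp.degree_eq_sum, ← Finset.prod_pow_eq_pow_sum, ← Finset.prod_mul_distrib]
          refine Finset.prod_congr rfl fun i _ => ?_
          rw [← mul_pow]; congr 1; field_simp
        rw [e1, ← mul_assoc (s ^ _), ← pow_add, Nat.sub_add_cancel hle]; ring
      rw [h2, h1, mul_zero]
  apply hv
  have h0 : R 0 = 0 := congrFun hR 0
  rw [← h0, MvPolynomial.homogeneousComponent_apply, map_sum, Finset.sum_filter]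
  refine Finset.sum_congr rfl fun m hm => ?_
  have hle : m.degree ≤ Q.totalDegree := MvPolynomial.le_totalDegree hm
  split_ifs with h
  · simp [h, MvPolynomial.eval_monomial, Finsupp.prod_fintype]
  · have : Q.totalDegree - m.degree ≠ 0 := by omega
    simp [this]

/-- Substitution `x ↦ x + t v`, as a polynomial in `t`. -/
noncomputable def lineHom {n : ℕ} (v : Fin n → ℝ) :
    MvPolynomial (Fin n) ℝ →ₐ[ℝ] Polynomial (MvPolynomial (Fin n) ℝ) :=
  MvPolynomial.aeval fun i => Polynomial.C (MvPolynomial.X i) +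
    Polynomial.X * Polynomial.C (MvPolynomial.C (v i))

theorem lineHom_eval {n : ℕ} (v x : Fin n → ℝ) (t : ℝ) (P : MvPolynomial (Fin n) ℝ) :
    ((lineHom v P).map (MvPolynomial.eval x)).eval t
      = MvPolynomial.eval (fun i => x i + t * v i) P := by
  induction P using MvPolynomial.induction_on with
  | C a =>
    have : lineHom v (MvPolynomial.C a) = Polynomial.C (MvPolynomial.C a) := by
      simp [lineHom]
    simp [this]
  | add p q hp hq => simp [hp, hq]
  | mul_X p i hp =>
    have : lineHom v (MvPolynomial.X i) = Polynomial.C (MvPolynomial.X i) +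
        Polynomial.X * Polynomial.C (MvPolynomial.C (v i)) := by
      simp only [lineHom, MvPolynomial.aeval_X]
    rw [map_mul, Polynomial.map_mul, Polynomial.eval_mul, hp, this]
    simp [mul_comm t]

theorem real_sign_mul' (a b : ℝ) : Real.sign (a * b) = Real.sign a * Real.sign b := by
  rcases lt_trichotomy a 0 with ha | ha | ha <;> rcases lt_trichotomy b 0 with hb | hb | hb <;>
  simp [ha, hb, Real.sign_of_pos, Real.sign_of_neg, mul_pos_of_neg_of_neg, mul_neg_of_pos_of_neg,
    mul_neg_of_neg_of_pos]

/-- the sign of a regulous function on a real algebraic set is a finite sum of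
signs of polynomial functions. -/
theorem sign_regulous_eq_sum_sign_poly {n : ℕ} (X : Set (Fin n → ℝ))
    (hX : IsRealAlgebraicSet X) (f : (Fin n → ℝ) → ℝ) (hf : IsRegulousOn X f) :
    ∃ (k : ℕ) (p : Fin k → MvPolynomial (Fin n) ℝ),
      ∀ x ∈ X, Real.sign (f x) = ∑ i, Real.sign (MvPolynomial.eval x (p i)) := by
  obtain ⟨g, ⟨hg, U, ⟨-, r, w, hw⟩, ⟨x₀, hx₀⟩, p, q, hq, hpq⟩, hfg⟩ := hf
  obtain ⟨P, Q, hQ, hPQ⟩ : ∃ P Q : MvPolynomial (Fin n) ℝ, Q ≠ 0 ∧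
      ∀ x, g x * MvPolynomial.eval x Q = MvPolynomial.eval x P := by
    have hx : ¬ ∀ i, MvPolynomial.eval x₀ (w i) = 0 := by
      intro h
      have : x₀ ∈ Set.univ \ U := by rw [hw]; exact h
      exact this.2 hx₀
    push Not at hx
    obtain ⟨i, hi⟩ := hx
    refine ⟨p * w i, q * w i, ?_, ?_⟩
    · intro h
      have := congrArg (MvPolynomial.eval x₀) h
      simp [hi, hq x₀ hx₀] at this
    · intro x
      by_cases hxU : x ∈ U
      · have := hq x hxU
        rw [hpq x hxU]; simp only [map_mul]; field_simp
      · have : x ∈ Set.univ \ U := ⟨trivial, hxU⟩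
        rw [hw] at this
        simp [this i]
  obtain ⟨v, hv⟩ := aux_dir Q hQ
  let a : ℕ → MvPolynomial (Fin n) ℝ := fun k => (lineHom v P).coeff k
  let b : ℕ → MvPolynomial (Fin n) ℝ := fun k => (lineHom v Q).coeff k
  let s : ℕ → MvPolynomial (Fin n) ℝ := fun k => ∑ j ∈ Finset.range k, b j ^ 2
  let d := (lineHom v Q).natDegree + 1
  refine ⟨d + d, Fin.append (fun k : Fin d => a k * b k) (fun k : Fin d => -(a k * b k * s k)), ?_⟩
  intro x hx
  rw [hfg x hx, Fin.sum_univ_add]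
  simp only [Fin.append_left, Fin.append_right]
  rw [← Finset.sum_add_distrib]
  have hex : ∃ k, MvPolynomial.eval x (b k) ≠ 0 := by
    by_contra! hc
    obtain ⟨t, ht⟩ := hv x
    apply ht
    rw [← lineHom_eval]
    have : (lineHom v Q).map (MvPolynomial.eval x) = 0 := by
      ext k; simpa using hc k
    simp [this]
  classical
  let K := Nat.find hex
  have hK : MvPolynomial.eval x (b K) ≠ 0 := Nat.find_spec hex
  have hKm : ∀ j < K, MvPolynomial.eval x (b j) = 0 := fun j hj => by
    simpa using Nat.find_min hex hj
  have hKd : K < d := by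
    by_contra! hc
    apply hK
    have : b K = 0 := Polynomial.coeff_eq_zero_of_natDegree_lt (by omega)
    simp [this]
  have hcoef : g x * MvPolynomial.eval x (b K) = MvPolynomial.eval x (a K) := by
    have := aux_coeff K ((lineHom v P).map (MvPolynomial.eval x))
      ((lineHom v Q).map (MvPolynomial.eval x)) (fun t => g (fun i => x i + t * v i))
      (hg.comp (by fun_prop)) (fun t => by rw [lineHom_eval, lineHom_eval]; exact hPQ _)
      (fun j hj => by simpa using hKm j hj)
    simpa using this
  have hs : ∀ k, MvPolynomial.eval x (s k) = ∑ j ∈ Finset.range k, MvPolynomial.eval x (b j) ^ 2 := by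
    intro k; simp [s]
  rw [Finset.sum_eq_single (⟨K, hKd⟩ : Fin d)]
  · have h0 : MvPolynomial.eval x (s K) = 0 := by
      rw [hs]
      exact Finset.sum_eq_zero fun j hj => by simp [hKm j (Finset.mem_range.1 hj)]
    simp only [map_neg, map_mul, h0, mul_zero, neg_zero, Real.sign_zero, add_zero]
    rw [← hcoef, mul_assoc, real_sign_mul', Real.sign_of_pos (mul_self_pos.2 hK), mul_one]
  · rintro ⟨k, hk⟩ - hne
    have hne : k ≠ K := fun h => hne (by ext; exact h)
    rcases lt_or_gt_of_ne hne with h | h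
    · simp [hKm k h]
    · have hpos : 0 < MvPolynomial.eval x (s k) := by
        rw [hs]
        exact Finset.sum_pos' (fun _ _ => sq_nonneg _)
          ⟨K, Finset.mem_range.2 h, by positivity⟩
      simp only [map_neg, map_mul, Real.sign_neg]
      rw [real_sign_mul' _ (MvPolynomial.eval x (s k)), Real.sign_of_pos hpos]
      ring
  · intro h; exact absurd (Finset.mem_univ _) h
end

section
/- Let X ⊆ ℝⁿ be a real algebraic set. A function φ : X → ℤ is a finite ℤ-linear combination of indicator functions of real algebraic subsets of X if and only if it is a finite ℤ-linear combination of indicator functions of regulous closed subsets of X. -/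
open MvPolynomial Set

theorem aux_limit (m : ℕ) : ∀ (P Q : Polynomial ℝ) (g : ℝ → ℝ), Continuous g →
    (∀ t, g t * Q.eval t = P.eval t) → (∀ k < m, Q.coeff k = 0) →
    g 0 * Q.coeff m = P.coeff m := by
  induction m with
  | zero =>
    intro P Q g _ h _
    have := h 0
    rwa [← Polynomial.coeff_zero_eq_eval_zero, ← Polynomial.coeff_zero_eq_eval_zero] at this
  | succ m ih =>
    intro P Q g hg h hQ
    have hQ0 : Q.coeff 0 = 0 := hQ 0 (Nat.succ_pos m)
    have hP0 : P.coeff 0 = 0 := by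
      have := h 0
      rw [← Polynomial.coeff_zero_eq_eval_zero, ← Polynomial.coeff_zero_eq_eval_zero, hQ0] at this
      simpa using this.symm
    have eQ : ∀ t, Q.eval t = Q.divX.eval t * t := by
      intro t
      conv_lhs => rw [← Polynomial.divX_mul_X_add Q]
      simp [hQ0]
    have eP : ∀ t, P.eval t = P.divX.eval t * t := by
      intro t
      conv_lhs => rw [← Polynomial.divX_mul_X_add P]
      simp [hP0]
    have key : (fun t => g t * Q.divX.eval t) = fun t => P.divX.eval t := by
      refine Continuous.ext_on (dense_compl_singleton (0 : ℝ))
        (hg.mul Q.divX.continuous) P.divX.continuous ?_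
      intro t ht
      have h1 := h t
      rw [eQ, eP, ← mul_assoc] at h1
      exact mul_right_cancel₀ ht h1
    have := ih P.divX Q.divX g hg (fun t => congrFun key t) (by
      intro k hk
      rw [Polynomial.coeff_divX]
      exact hQ _ (by omega))
    simpa [Polynomial.coeff_divX] using this

/-- The polynomial `q (x + t v)` in the variable `t`. -/
noncomputable def lineShift {n : ℕ} (v : Fin n → ℝ) (q : MvPolynomial (Fin n) ℝ) :
    Polynomial (MvPolynomial (Fin n) ℝ) :=
  MvPolynomial.eval₂ (Polynomial.C.comp MvPolynomial.C)
    (fun i => Polynomial.C (MvPolynomial.X i) + Polynomial.X * Polynomial.C (MvPolynomial.C (v i))) q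

theorem lineShift_eval {n : ℕ} (v x : Fin n → ℝ) (q : MvPolynomial (Fin n) ℝ) (t : ℝ) :
    ((lineShift v q).map (MvPolynomial.eval x)).eval t
      = MvPolynomial.eval (fun i => x i + t * v i) q := by
  unfold lineShift
  induction q using MvPolynomial.induction_on with
  | C a => simp
  | add p q hp hq =>
    rw [MvPolynomial.eval₂_add, Polynomial.map_add, Polynomial.eval_add, hp, hq, map_add]
  | mul_X p i hp =>
    rw [MvPolynomial.eval₂_mul, Polynomial.map_mul, Polynomial.eval_mul, hp, map_mul]
    simp only [MvPolynomial.eval₂_X, Polynomial.map_add, Polynomial.map_mul, Polynomial.map_C,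
      Polynomial.map_X, Polynomial.eval_add, Polynomial.eval_mul, Polynomial.eval_C,
      Polynomial.eval_X, MvPolynomial.eval_X, MvPolynomial.eval_C]

def ZS {n : ℕ} (I : Ideal (MvPolynomial (Fin n) ℝ)) : Set (Fin n → ℝ) :=
  {x | ∀ p ∈ I, MvPolynomial.eval x p = 0}

theorem ZS_span {n : ℕ} (S : Set (MvPolynomial (Fin n) ℝ)) :
    ZS (Ideal.span S) = {x | ∀ p ∈ S, MvPolynomial.eval x p = 0} := by
  ext x
  constructor
  · intro h p hp
    exact h p (Ideal.subset_span hp)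
  · intro h p hp
    have : Ideal.span S ≤ RingHom.ker (MvPolynomial.eval x) :=
      Ideal.span_le.2 fun q hq => h q hq
    exact this hp

theorem ZS_alg {n : ℕ} (I : Ideal (MvPolynomial (Fin n) ℝ)) : IsRealAlgebraicSet (ZS I) := by
  obtain ⟨k, p, hp⟩ := Submodule.fg_iff_exists_fin_generating_family.1
    (IsNoetherian.noetherian I)
  refine ⟨k, p, ?_⟩
  have : I = Ideal.span (Set.range p) := hp.symm
  rw [this, ZS_span]
  ext x; simp

theorem ZS_sup {n : ℕ} (I J : Ideal (MvPolynomial (Fin n) ℝ)) : ZS (I ⊔ J) = ZS I ∩ ZS J := by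
  ext x
  constructor
  · intro h
    exact ⟨fun p hp => h p (Ideal.mem_sup_left hp), fun p hp => h p (Ideal.mem_sup_right hp)⟩
  · rintro ⟨h1, h2⟩ p hp
    obtain ⟨a, ha, b, hb, rfl⟩ := Submodule.mem_sup.1 hp
    simp [h1 a ha, h2 b hb]

theorem ZS_single {n : ℕ} (q : MvPolynomial (Fin n) ℝ) :
    ZS (Ideal.span {q}) = {x | MvPolynomial.eval x q = 0} := by
  rw [ZS_span]; simp

theorem regulous_eq {n : ℕ} {f : (Fin n → ℝ) → ℝ} (hf : IsRegulous f) :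
    ∃ p q : MvPolynomial (Fin n) ℝ, (∃ y, MvPolynomial.eval y q ≠ 0) ∧
      ∀ x, f x * MvPolynomial.eval x q = MvPolynomial.eval x p := by
  obtain ⟨_, U, ⟨_, k, r, hr⟩, ⟨y, hy⟩, p, q, hq, hpq⟩ := hf
  have hy' : y ∉ {x | ∀ i, MvPolynomial.eval x (r i) = 0} := by
    rw [← hr]; exact fun h => h.2 hy
  simp only [Set.mem_setOf_eq, not_forall] at hy'
  obtain ⟨i, hi⟩ := hy'
  refine ⟨p * r i, q * r i, ⟨y, ?_⟩, fun x => ?_⟩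
  · rw [map_mul]; exact mul_ne_zero (hq y hy) hi
  · by_cases hx : MvPolynomial.eval x (r i) = 0
    · simp [hx]
    · have hxU : x ∈ U := by
        by_contra hxU
        have : x ∈ Set.univ \ U := ⟨trivial, hxU⟩
        rw [hr] at this
        exact hx (this i)
      have h0 := hq x hxU
      rw [hpq x hxU, map_mul, map_mul]
      field_simp

/-- Indicators of algebraic subsets of `X`. -/
def indSet {n : ℕ} (X : Set (Fin n → ℝ)) : Set ((Fin n → ℝ) → ℤ) :=
  {φ | ∃ V, IsZariskiClosedIn X V ∧ φ = V.indicator 1}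

theorem main_aux {n : ℕ} (X : Set (Fin n → ℝ)) {f : (Fin n → ℝ) → ℝ} (hf : IsRegulous f)
    (I : Ideal (MvPolynomial (Fin n) ℝ)) : ZS I ⊆ X →
    (ZS I ∩ {x | f x = 0}).indicator (1 : (Fin n → ℝ) → ℤ) ∈ Submodule.span ℤ (indSet X) := by
  obtain ⟨p, q, ⟨y, hy⟩, hpq⟩ := regulous_eq hf
  induction I using WellFoundedGT.induction with
  | ind I ih =>
  intro hI
  rcases Set.eq_empty_or_nonempty (ZS I) with h0 | ⟨x₀, hx₀⟩
  · rw [h0, Set.empty_inter, Set.indicator_empty]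
    exact Submodule.zero_mem _
  set v : Fin n → ℝ := fun i => y i - x₀ i with hv
  have hex : ∃ m, ∃ x ∈ ZS I, MvPolynomial.eval x ((lineShift v q).coeff m) ≠ 0 := by
    by_contra! hcon
    have h1 : (lineShift v q).map (MvPolynomial.eval x₀) = 0 := by
      ext m
      simpa using hcon m x₀ hx₀
    have h2 := lineShift_eval v x₀ q 1
    rw [h1] at h2
    apply hy
    simpa [hv] using h2.symm
  classical
  obtain ⟨x₁, hx₁, hm⟩ := Nat.find_spec hex
  have hmin : ∀ k < Nat.find hex, ∀ x ∈ ZS I,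
      MvPolynomial.eval x ((lineShift v q).coeff k) = 0 := by
    intro k hk x hx
    have := Nat.find_min hex hk
    push Not at this
    exact this x hx
  generalize Nat.find hex = m at hm hmin
  set a := (lineShift v p).coeff m
  set b := (lineShift v q).coeff m
  have key : ∀ x ∈ ZS I, f x * MvPolynomial.eval x b = MvPolynomial.eval x a := by
    intro x hx
    have := aux_limit m ((lineShift v p).map (MvPolynomial.eval x))
      ((lineShift v q).map (MvPolynomial.eval x)) (fun t => f (fun i => x i + t * v i))
      (hf.1.comp (by fun_prop))
      (fun t => by rw [lineShift_eval, lineShift_eval]; exact hpq _)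
      (fun k hk => by rw [Polynomial.coeff_map]; exact hmin k hk x hx)
    simpa using this
  have hlt : I < I ⊔ Ideal.span {b} := by
    refine lt_of_le_of_ne le_sup_left fun h => hm ?_
    have : b ∈ I := by
      rw [h]; exact Ideal.mem_sup_right (Ideal.mem_span_singleton_self b)
    exact hx₁ b this
  have hsub : ∀ J, ZS (I ⊔ J) ⊆ X := fun J => by
    rw [ZS_sup]; exact fun x hx => hI hx.1
  have h1 := ih _ hlt (hsub _)
  have h2 : (ZS (I ⊔ Ideal.span {a})).indicator (1 : (Fin n → ℝ) → ℤ)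
      ∈ Submodule.span ℤ (indSet X) :=
    Submodule.subset_span ⟨_, ⟨ZS_alg _, hsub _⟩, rfl⟩
  have h3 : (ZS (I ⊔ (Ideal.span {a} ⊔ Ideal.span {b}))).indicator (1 : (Fin n → ℝ) → ℤ)
      ∈ Submodule.span ℤ (indSet X) :=
    Submodule.subset_span ⟨_, ⟨ZS_alg _, hsub _⟩, rfl⟩
  convert Submodule.add_mem _ (Submodule.sub_mem _ h2 h3) h1 using 1
  ext x
  simp only [ZS_sup, ZS_single, Pi.add_apply, Pi.sub_apply, Set.indicator_apply, Set.mem_inter_iff,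
    Set.mem_setOf_eq, Pi.one_apply]
  by_cases hx : x ∈ ZS I
  · have hk := key x hx
    by_cases hb : MvPolynomial.eval x b = 0
    · simp [hx, hb]
    · have : MvPolynomial.eval x a = 0 ↔ f x = 0 := by
        rw [← hk]; simp [hb]
      simp [hx, hb, this]
  · simp [hx]

theorem alg_regulousClosed {n : ℕ} {X V : Set (Fin n → ℝ)} (h : IsZariskiClosedIn X V) :
    IsRegulousClosedIn X V := by
  obtain ⟨⟨k, p, rfl⟩, hVX⟩ := h
  refine ⟨fun x => MvPolynomial.eval x (∑ i, p i ^ 2), ⟨_, ⟨?_, Set.univ, ⟨subset_rfl, 1,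
    fun _ => 1, by simp⟩, Set.univ_nonempty, ∑ i, p i ^ 2, 1, by simp, by simp⟩,
    fun _ _ => rfl⟩, ?_⟩
  · exact MvPolynomial.continuous_eval _
  · ext x
    have : MvPolynomial.eval x (∑ i, p i ^ 2) = 0 ↔ ∀ i, MvPolynomial.eval x (p i) = 0 := by
      rw [map_sum, Finset.sum_eq_zero_iff_of_nonneg (fun i _ => by rw [map_pow]; positivity)]
      simp
    constructor
    · intro hx
      exact ⟨hVX hx, this.2 hx⟩
    · rintro ⟨_, hx⟩
      exact this.1 hx


/-- a function `φ : X → ℤ` is a finite ℤ-linear combination of indicator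
functions of real algebraic subsets of `X` iff it is a finite ℤ-linear combination of
indicator functions of regulous closed subsets of `X`. -/
theorem stronglyAlgConstructible_iff_regulousClosed_combination {n : ℕ}
    (X : Set (Fin n → ℝ)) (hX : IsRealAlgebraicSet X) (φ : (Fin n → ℝ) → ℤ) :
    (∃ (k : ℕ) (m : Fin k → ℤ) (V : Fin k → Set (Fin n → ℝ)),
        (∀ i, IsZariskiClosedIn X (V i)) ∧
        ∀ x ∈ X, φ x = ∑ i, m i * (V i).indicator 1 x) ↔
      (∃ (k : ℕ) (m : Fin k → ℤ) (V : Fin k → Set (Fin n → ℝ)),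
        (∀ i, IsRegulousClosedIn X (V i)) ∧
        ∀ x ∈ X, φ x = ∑ i, m i * (V i).indicator 1 x) := by
  constructor
  · rintro ⟨k, m, V, hV, hφ⟩
    exact ⟨k, m, V, fun i => alg_regulousClosed (hV i), hφ⟩
  · rintro ⟨k, m, V, hV, hφ⟩
    have hmem : (∑ i, m i • (V i).indicator (1 : (Fin n → ℝ) → ℤ)) ∈
        Submodule.span ℤ (indSet X) := by
      refine Submodule.sum_mem _ fun i _ => Submodule.smul_mem _ _ ?_
      obtain ⟨f, ⟨g, hg, hfg⟩, hVi⟩ := hV i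
      obtain ⟨l, p, hp⟩ := hX
      have hXI : X = ZS (Ideal.span (Set.range p)) := by
        rw [ZS_span, hp]; ext x; simp
      have := main_aux X hg (Ideal.span (Set.range p)) hXI.ge
      rw [← hXI] at this
      have e : V i = X ∩ {x | g x = 0} := by
        rw [hVi]
        ext x
        constructor
        · rintro ⟨h1, h2⟩
          exact ⟨h1, by rw [Set.mem_setOf_eq, ← hfg x h1]; exact h2⟩
        · rintro ⟨h1, h2⟩
          exact ⟨h1, by rw [hfg x h1]; exact h2⟩
      rw [e]; exact this
    obtain ⟨K, c, G, hG⟩ := Submodule.mem_span_set'.1 hmem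
    choose W hW hGW using fun i => (G i).2
    refine ⟨K, c, W, hW, fun x hx => ?_⟩
    rw [hφ x hx]
    have h := congrFun hG x
    simp only [Finset.sum_apply, Pi.smul_apply, smul_eq_mul, hGW] at h
    exact h.symm
end

section
/- Let X ⊆ ℝⁿ be a real algebraic set and let f be a continuous semi-algebraic function on X. There exists a polynomial function p on X such that sign(f) = sign(p) on X if and only if the following three conditions hold: (1) Z(f) is Zariski closed, i.e. Z(f) is a real algebraic subset of X; (2) S(f) is principal open, i.e. S(f) = S(p₁) for some polynomial function p₁ on X; (3) S(−f) is principal open. -/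
open MvPolynomial Set

/-- for a continuous semi-algebraic function `f` on `X`, the sign of `f` is the
sign of a polynomial function iff `Z(f)` is Zariski closed, `S(f)` is principal open and
`S(-f)` is principal open. -/
theorem sign_eq_sign_poly_iff {n : ℕ} (X : Set (Fin n → ℝ)) (hX : IsRealAlgebraicSet X)
    (f : (Fin n → ℝ) → ℝ) (hfc : ContinuousOn f X) (hfsa : IsSemialgebraicFnOn X f) :
    (∃ p : MvPolynomial (Fin n) ℝ,
        ∀ x ∈ X, Real.sign (f x) = Real.sign (MvPolynomial.eval x p)) ↔
      (IsZariskiClosedIn X {x ∈ X | f x = 0} ∧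
        (∃ p₁ : MvPolynomial (Fin n) ℝ,
          {x ∈ X | 0 < f x} = {x ∈ X | 0 < MvPolynomial.eval x p₁}) ∧
        (∃ p₂ : MvPolynomial (Fin n) ℝ,
          {x ∈ X | 0 < -f x} = {x ∈ X | 0 < MvPolynomial.eval x p₂})) := by
  constructor
  · rintro ⟨p, hp⟩
    have key : ∀ x ∈ X, (0 < f x ↔ 0 < MvPolynomial.eval x p) ∧
        (f x < 0 ↔ MvPolynomial.eval x p < 0) ∧ (f x = 0 ↔ MvPolynomial.eval x p = 0) := by
      intro x hx
      have h := hp x hx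
      rcases lt_trichotomy (f x) 0 with h1 | h1 | h1 <;>
      rcases lt_trichotomy (MvPolynomial.eval x p) 0 with h2 | h2 | h2 <;>
      simp only [Real.sign_of_neg, Real.sign_of_pos, Real.sign_zero, h1, h2] at h <;>
      first
        | (exfalso; norm_num at h; done)
        | (refine ⟨⟨fun _ => ?_, fun _ => ?_⟩, ⟨fun _ => ?_, fun _ => ?_⟩,
            ⟨fun _ => ?_, fun _ => ?_⟩⟩ <;> linarith)
    obtain ⟨k, P, hP⟩ := hX
    refine ⟨⟨⟨k + 1, Fin.cons p P, ?_⟩, fun x hx => hx.1⟩, ⟨p, ?_⟩, ⟨-p, ?_⟩⟩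
    · ext x
      have hm : x ∈ X ↔ ∀ i, MvPolynomial.eval x (P i) = 0 := by rw [hP]; rfl
      simp only [Set.mem_setOf_eq, Fin.forall_fin_succ, Fin.cons_zero, Fin.cons_succ]
      rw [← hm]
      constructor
      · rintro ⟨hx, h⟩
        exact ⟨(key x hx).2.2.1 h, hx⟩
      · rintro ⟨h, hx⟩
        exact ⟨hx, (key x hx).2.2.2 h⟩
    · ext x
      exact and_congr_right fun hx => (key x hx).1
    · ext x
      refine and_congr_right fun hx => ?_
      rw [map_neg, neg_pos, neg_pos]
      exact (key x hx).2.1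
  · rintro ⟨⟨⟨k, P, hP⟩, -⟩, ⟨p₁, h₁⟩, ⟨p₂, h₂⟩⟩
    refine ⟨(∑ i, P i ^ 2) * (p₁ - p₂), fun x hx => ?_⟩
    have e₁ : 0 < f x ↔ 0 < MvPolynomial.eval x p₁ := by
      have := Set.ext_iff.1 h₁ x
      simpa [hx] using this
    have e₂ : f x < 0 ↔ 0 < MvPolynomial.eval x p₂ := by
      have := Set.ext_iff.1 h₂ x
      simpa [hx] using this
    have e₀ : f x = 0 ↔ ∀ i, MvPolynomial.eval x (P i) = 0 := by
      have := Set.ext_iff.1 hP x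
      simpa [hx] using this
    have hq : MvPolynomial.eval x (∑ i, P i ^ 2) = ∑ i, (MvPolynomial.eval x (P i)) ^ 2 := by
      simp
    have hq0 : 0 ≤ MvPolynomial.eval x (∑ i, P i ^ 2) := by
      rw [hq]; exact Finset.sum_nonneg fun i _ => sq_nonneg _
    have hqz : MvPolynomial.eval x (∑ i, P i ^ 2) = 0 ↔ f x = 0 := by
      rw [hq, e₀, Finset.sum_eq_zero_iff_of_nonneg fun i _ => sq_nonneg _]
      simp
    rw [map_mul, map_sub]
    rcases lt_trichotomy (f x) 0 with h | h | h
    · have hpos := lt_of_le_of_ne hq0 fun h' => h.ne (hqz.1 h'.symm)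
      have a := e₂.1 h
      have b := not_lt.1 (fun h' => h.not_gt (e₁.2 h'))
      rw [Real.sign_of_neg h, Real.sign_of_neg (mul_neg_of_pos_of_neg hpos (by linarith))]
    · rw [hqz.2 h, h, zero_mul]
    · have hpos := lt_of_le_of_ne hq0 fun h' => h.ne' (hqz.1 h'.symm)
      have a := e₁.1 h
      have b := not_lt.1 (fun h' => h.not_gt (e₂.2 h'))
      rw [Real.sign_of_pos h, Real.sign_of_pos (mul_pos hpos (by linarith))]
end
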